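/- Let E: y² + a₁xy + a₃y = x³ + a₂x² + a₄x with a₁,a₂,a₃,a₄ ∈ ℤ be an elliptic curve (nonzero discriminant Δ), let p be a prime with p ∤ Δ, and set A_p = 1 + #{(x,y) ∈ 𝔽_p × 𝔽_p : y² + a₁xy + a₃y = x³ + a₂x² + a₄x}, t_p = 1 + p − A_p. Then for every s ≥ 1 and every positive integer n with p^{s−1} ∣ n, one has b(np) − t_p·b(n) + p·b(n‖p) ≡ 0 (mod p^{s}), where b(n‖p) = b(n/p) if p ∣ n and b(n‖p) = 0 otherwise, and b(n+1) = Σ_{m=⌊n/2⌋}^{n} Σ_{k=0}^{⌊m/2⌋} Σ_{r=0}^{n−m−k} C(m,k)C(m−k,k)C(m−2k,r)C(k,n−m−k−r) a₁^{m−2k−r} a₂^{r} a₃^{2k−n+m+r} a₄^{n−m−k−r}. -/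

import Mathlib

open PowerSeries Finset

/-- `bCoeff a₁ a₂ a₃ a₄ n = b(n+1)`, the coefficient of `zⁿ` in the `z`-expansion of the
invariant differential of `y² + a₁xy + a₃y = x³ + a₂x² + a₄x`. -/
def bCoeff (a₁ a₂ a₃ a₄ : ℤ) (n : ℕ) : ℤ :=
  ∑ m ∈ Finset.Icc (n / 2) n, ∑ k ∈ Finset.range (m / 2 + 1),
    ∑ r ∈ Finset.range (n + 1 - m - k),
      (m.choose k * (m - k).choose k * (m - 2 * k).choose r *
        k.choose (n - m - k - r) : ℤ) *
        a₁ ^ (m - 2 * k - r) * a₂ ^ r * a₃ ^ (2 * k + m + r - n) * a₄ ^ (n - m - k - r)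

namespace WeierstrassCurve

section XCoordinates

variable {R : Type*} [CommRing R] (W : WeierstrassCurve R)

/-- If `(s : t : u)` are the symmetric coordinates of the pair `x(P), x(Q)`, then
`(sumDiffProd : sumDiffSum : sumDiffDen)` are those of the pair `x(P + Q), x(P - Q)`. -/
def sumDiffProd (s t u : R) : R := s ^ 2 - W.b₄ * s * u - W.b₆ * t * u - W.b₈ * u ^ 2

/-- The second symmetric coordinate of the pair `x(P + Q), x(P - Q)`. -/
def sumDiffSum (s t u : R) : R := 2 * t * s + W.b₂ * s * u + W.b₄ * t * u + W.b₆ * u ^ 2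

/-- The third symmetric coordinate of the pair `x(P + Q), x(P - Q)`. -/
def sumDiffDen (s t u : R) : R := t ^ 2 - 4 * s * u

theorem sumDiff_nondegenerate [W.IsElliptic] [IsReduced R] {s t u : R}
    (h₀ : W.sumDiffProd s t u = 0) (h₁ : W.sumDiffSum s t u = 0) (h₂ : sumDiffDen s t u = 0) :
    s = 0 ∧ t = 0 ∧ u = 0 := by
  by_contra hne
  have hx : ![s, t, u] ≠ 0 := by
    intro h
    exact hne ⟨congrFun h 0, congrFun h 1, congrFun h 2⟩
  refine W.addSubMap_ne_zero hx (funext fun i => ?_)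
  fin_cases i
  · simpa [addSubMap, sumDiffProd] using h₀
  · simpa [addSubMap, sumDiffSum] using h₁
  · simpa [addSubMap, sumDiffDen] using h₂

end XCoordinates

section SumDiff

variable {F : Type*} [Field F] [DecidableEq F] (W : Affine F)

open Affine.Point

theorem sumDiff_of_X_ne {x₁ y₁ x₂ y₂ : F} (h₁ : W.Equation x₁ y₁) (h₂ : W.Equation x₂ y₂)
    (hx : x₁ ≠ x₂) :
    (x₁ - x₂) ^ 2 * (W.addX x₁ x₂ (W.slope x₁ x₂ y₁ y₂) *
        W.addX x₁ x₂ (W.slope x₁ x₂ y₁ (W.negY x₂ y₂))) =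
      W.sumDiffProd (x₁ * x₂) (x₁ + x₂) 1 ∧
    (x₁ - x₂) ^ 2 * (W.addX x₁ x₂ (W.slope x₁ x₂ y₁ y₂) +
        W.addX x₁ x₂ (W.slope x₁ x₂ y₁ (W.negY x₂ y₂))) =
      W.sumDiffSum (x₁ * x₂) (x₁ + x₂) 1 := by
  have hd : x₁ - x₂ ≠ 0 := sub_ne_zero.mpr hx
  rw [Affine.equation_iff] at h₁ h₂
  rw [Affine.slope_of_X_ne hx, Affine.slope_of_X_ne hx]
  simp only [Affine.addX, Affine.negY, sumDiffProd, sumDiffSum, b₂, b₄, b₆, b₈]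
  have key : ∀ y : F, (x₁ - x₂) ^ 2 *
      (((y₁ - y) / (x₁ - x₂)) ^ 2 + W.a₁ * ((y₁ - y) / (x₁ - x₂)) - W.a₂ - x₁ - x₂) =
      (y₁ - y) ^ 2 + W.a₁ * (y₁ - y) * (x₁ - x₂) - (W.a₂ + x₁ + x₂) * (x₁ - x₂) ^ 2 := by
    intro y
    field_simp
    ring
  constructor
  · apply mul_left_cancel₀ (pow_ne_zero 2 hd)
    rw [show ∀ d A B : F, d * (d * (A * B)) = (d * A) * (d * B) by intros; ring, key, key]
    have e₁ : (y₁ - y₂) ^ 2 + W.a₁ * (y₁ - y₂) * (x₁ - x₂) -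
        (W.a₂ + x₁ + x₂) * (x₁ - x₂) ^ 2 =
        (x₁ + x₂) * (x₁ * x₂ + W.a₄) + 2 * W.a₂ * x₁ * x₂ + 2 * W.a₆ -
          y₁ * (W.a₁ * x₂ + W.a₃) - y₂ * (2 * y₁ + W.a₁ * x₁ + W.a₃) := by
      linear_combination h₁ + h₂
    have e₂ : (y₁ - (-y₂ - W.a₁ * x₂ - W.a₃)) ^ 2 +
        W.a₁ * (y₁ - (-y₂ - W.a₁ * x₂ - W.a₃)) * (x₁ - x₂) -
        (W.a₂ + x₁ + x₂) * (x₁ - x₂) ^ 2 =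
        (x₁ + x₂) * (x₁ * x₂ + W.a₄) + 2 * W.a₂ * x₁ * x₂ + 2 * W.a₆ -
          y₁ * (W.a₁ * x₂ + W.a₃) -
          (-y₂ - W.a₁ * x₂ - W.a₃) * (2 * y₁ + W.a₁ * x₁ + W.a₃) := by
      linear_combination h₁ + h₂
    rw [e₁, e₂]
    linear_combination (-(W.a₁ * x₂ + W.a₃) ^ 2 -
      4 * (x₂ ^ 3 + W.a₂ * x₂ ^ 2 + W.a₄ * x₂ + W.a₆)) * h₁ -
      (2 * y₁ + W.a₁ * x₁ + W.a₃) ^ 2 * h₂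
  · rw [mul_add, key, key]
    linear_combination 2 * h₁ + 2 * h₂

theorem sumDiff_self {x y : F} (h : W.Equation x y) (hy : y ≠ W.negY x y) :
    (2 * y + W.a₁ * x + W.a₃) ^ 2 * W.addX x x (W.slope x x y y) =
      W.sumDiffProd (x * x) (x + x) 1 ∧
    (2 * y + W.a₁ * x + W.a₃) ^ 2 = W.sumDiffSum (x * x) (x + x) 1 := by
  have hψ : 2 * y + W.a₁ * x + W.a₃ ≠ 0 := by
    contrapose! hy
    rw [Affine.negY]
    linear_combination hy
  rw [Affine.equation_iff] at h
  rw [Affine.slope_of_Y_ne rfl hy,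
    show y - W.negY x y = 2 * y + W.a₁ * x + W.a₃ by rw [Affine.negY]; ring]
  simp only [Affine.addX, sumDiffProd, sumDiffSum, b₂, b₄, b₆, b₈]
  constructor
  · have : (2 * y + W.a₁ * x + W.a₃) ^ 2 *
        (((3 * x ^ 2 + 2 * W.a₂ * x + W.a₄ - W.a₁ * y) / (2 * y + W.a₁ * x + W.a₃)) ^ 2 +
          W.a₁ * ((3 * x ^ 2 + 2 * W.a₂ * x + W.a₄ - W.a₁ * y) / (2 * y + W.a₁ * x + W.a₃)) -
          W.a₂ - x - x) = (3 * x ^ 2 + 2 * W.a₂ * x + W.a₄ - W.a₁ * y) ^ 2 +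
          W.a₁ * (3 * x ^ 2 + 2 * W.a₂ * x + W.a₄ - W.a₁ * y) * (2 * y + W.a₁ * x + W.a₃) -
          (W.a₂ + x + x) * (2 * y + W.a₁ * x + W.a₃) ^ 2 := by
      field_simp
      ring
    rw [this]
    linear_combination (-W.a₁ ^ 2 - 4 * W.a₂ - 8 * x) * h
  · linear_combination 4 * h

/-- The pair `x(P + Q), x(P - Q)` in terms of the pair `x(P), x(Q)`. -/
theorem exists_sym2x_add_sub [W.IsElliptic] (P Q : W.Point) :
    ∃ c : F, c ≠ 0 ∧
      c * ((P + Q).xRep 0 * (P - Q).xRep 0) = W.sumDiffProd (P.xRep 0 * Q.xRep 0)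
        (P.xRep 0 * Q.xRep 1 + P.xRep 1 * Q.xRep 0) (P.xRep 1 * Q.xRep 1) ∧
      c * ((P + Q).xRep 0 * (P - Q).xRep 1 + (P + Q).xRep 1 * (P - Q).xRep 0) =
        W.sumDiffSum (P.xRep 0 * Q.xRep 0)
        (P.xRep 0 * Q.xRep 1 + P.xRep 1 * Q.xRep 0) (P.xRep 1 * Q.xRep 1) ∧
      c * ((P + Q).xRep 1 * (P - Q).xRep 1) = sumDiffDen (P.xRep 0 * Q.xRep 0)
        (P.xRep 0 * Q.xRep 1 + P.xRep 1 * Q.xRep 0) (P.xRep 1 * Q.xRep 1) := by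
  have hdouble : ∀ {x y : F} (h : W.Nonsingular x y), ∃ c : F, c ≠ 0 ∧
      c * ((.some x y h + .some x y h : W.Point)).xRep 0 = W.sumDiffProd (x * x) (x + x) 1 ∧
      c * ((.some x y h + .some x y h : W.Point)).xRep 1 = W.sumDiffSum (x * x) (x + x) 1 := by
    intro x y h
    by_cases hy : y = W.negY x y
    · have h2 : W.sumDiffSum (x * x) (x + x) 1 = 0 := by
        rw [Affine.negY] at hy
        have h' := h.1
        rw [Affine.equation_iff] at h'
        simp only [sumDiffSum, b₂, b₄, b₆]
        linear_combination -4 * h' + (2 * y + W.a₁ * x + W.a₃) * hy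
      refine ⟨W.sumDiffProd (x * x) (x + x) 1, fun h0 => ?_, ?_, ?_⟩
      · exact one_ne_zero (W.sumDiff_nondegenerate h0 h2 (by rw [sumDiffDen]; ring)).2.2
      · rw [add_of_Y_eq rfl hy]; simp
      · rw [add_of_Y_eq rfl hy]; simp [h2]
    · obtain ⟨e₁, e₂⟩ := W.sumDiff_self h.1 hy
      refine ⟨(2 * y + W.a₁ * x + W.a₃) ^ 2, pow_ne_zero 2 ?_, ?_, ?_⟩
      · contrapose! hy
        rw [Affine.negY]
        linear_combination hy
      · rw [add_some (fun h => hy h.2)]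
        simpa using e₁
      · rw [add_some (fun h => hy h.2)]
        simpa using e₂
  have hden : ∀ x : F, sumDiffDen (x * x) (x + x) 1 = 0 := fun x => by rw [sumDiffDen]; ring
  match P, Q with
  | 0, 0 => exact ⟨1, one_ne_zero, by simp [sumDiffProd, sumDiffSum, sumDiffDen]⟩
  | 0, .some x y h =>
    refine ⟨1, one_ne_zero, ?_⟩
    simp [sumDiffProd, sumDiffSum, sumDiffDen]
    constructor <;> ring
  | .some x y h, 0 =>
    refine ⟨1, one_ne_zero, ?_⟩
    simp [sumDiffProd, sumDiffSum, sumDiffDen]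
    constructor <;> ring
  | .some x₁ y₁ h₁, .some x₂ y₂ h₂ =>
    by_cases hx : x₁ = x₂
    · subst hx
      obtain hPQ | hPQ := (X_eq_iff (h₁ := h₁) (h₂ := h₂)).mp rfl
      · obtain ⟨c, hc, e₁, e₂⟩ := hdouble h₁
        refine ⟨c, hc, ?_⟩
        rw [← hPQ, sub_self]
        simp [e₁, e₂, hden]
      · obtain ⟨c, hc, e₁, e₂⟩ := hdouble h₁
        refine ⟨c, hc, ?_⟩
        have : (.some x₁ y₂ h₂ : W.Point) = -.some x₁ y₁ h₁ := by rw [hPQ, neg_neg]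
        rw [this, add_neg_cancel, sub_neg_eq_add]
        simp [e₁, e₂, hden]
    · obtain ⟨e₁, e₂⟩ := W.sumDiff_of_X_ne h₁.1 h₂.1 hx
      refine ⟨(x₁ - x₂) ^ 2, pow_ne_zero 2 (sub_ne_zero.mpr hx), ?_⟩
      rw [sub_eq_add_neg (Affine.Point.some x₁ y₁ h₁), neg_some, add_of_X_ne hx, add_of_X_ne hx]
      simp only [xRep_some, Matrix.cons_val_zero, Matrix.cons_val_one, mul_one, one_mul]
      refine ⟨e₁, e₂, ?_⟩
      rw [sumDiffDen]
      ring

end SumDiff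

section Height

open scoped Polynomial WeierstrassCurve.Affine

variable {k : Type*} [Field k]

/-- The pair `f, g` has formal degree exactly `n`. -/
def IsTopDegree (f g : k[X]) (n : ℕ) : Prop :=
  f.natDegree ≤ n ∧ g.natDegree ≤ n ∧ (f.coeff n ≠ 0 ∨ g.coeff n ≠ 0)

theorem exists_isTopDegree {f g : k[X]} (h : IsCoprime f g) : ∃ n, IsTopDegree f g n := by
  have h0 : f ≠ 0 ∨ g ≠ 0 := by
    by_contra! h'
    rw [h'.1, h'.2] at h
    exact not_isCoprime_zero_zero h
  obtain h' | h' := le_total f.natDegree g.natDegree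
  · refine ⟨g.natDegree, h', le_rfl, ?_⟩
    by_cases hg : g = 0
    · subst hg
      have := h0.resolve_right (not_not.mpr rfl)
      rw [Polynomial.natDegree_zero, Nat.le_zero] at h'
      left
      rw [Polynomial.natDegree_zero, ← h']
      exact Polynomial.leadingCoeff_ne_zero.mpr this
    · exact Or.inr (Polynomial.leadingCoeff_ne_zero.mpr hg)
  · refine ⟨f.natDegree, le_rfl, h', ?_⟩
    by_cases hf : f = 0
    · subst hf
      have := h0.resolve_left (not_not.mpr rfl)
      rw [Polynomial.natDegree_zero, Nat.le_zero] at h'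
      right
      rw [Polynomial.natDegree_zero, ← h']
      exact Polynomial.leadingCoeff_ne_zero.mpr this
    · exact Or.inl (Polynomial.leadingCoeff_ne_zero.mpr hf)

theorem coeff_mul_add {f g : k[X]} {m n : ℕ} (hf : f.natDegree ≤ m) (hg : g.natDegree ≤ n) :
    (f * g).coeff (m + n) = f.coeff m * g.coeff n :=
  Polynomial.coeff_mul_add_eq_of_natDegree_le hf hg

variable (W : Affine k)

theorem natDegree_symm {a₁ b₁ a₂ b₂ : k[X]} {m n : ℕ} (ha₁ : a₁.natDegree ≤ m)
    (hb₁ : b₁.natDegree ≤ m) (ha₂ : a₂.natDegree ≤ n) (hb₂ : b₂.natDegree ≤ n) :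
    ((a₁ * b₂ + b₁ * a₂).natDegree ≤ m + n) ∧
    (a₁ * b₂ + b₁ * a₂).coeff (m + n) = a₁.coeff m * b₂.coeff n + b₁.coeff m * a₂.coeff n := by
  refine ⟨(Polynomial.natDegree_add_le _ _).trans (max_le ?_ ?_), ?_⟩
  · exact Polynomial.natDegree_mul_le_of_le ha₁ hb₂
  · exact Polynomial.natDegree_mul_le_of_le hb₁ ha₂
  · rw [Polynomial.coeff_add, coeff_mul_add ha₁ hb₂, coeff_mul_add hb₁ ha₂]

theorem symm_ne_zero {F : Type*} [Field F] {α₁ β₁ α₂ β₂ : F} (h₁ : α₁ ≠ 0 ∨ β₁ ≠ 0)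
    (h₂ : α₂ ≠ 0 ∨ β₂ ≠ 0) : ¬ (α₁ * α₂ = 0 ∧ α₁ * β₂ + β₁ * α₂ = 0 ∧ β₁ * β₂ = 0) := by
  rintro ⟨h, h', h''⟩
  by_cases hα₁ : α₁ = 0
  · have hβ₁ := h₁.resolve_left (not_not.mpr hα₁)
    have hβ₂ : β₂ = 0 := (mul_eq_zero.mp h'').resolve_left hβ₁
    rw [hβ₂, mul_zero, zero_add] at h'
    have hα₂ : α₂ = 0 := (mul_eq_zero.mp h').resolve_left hβ₁
    simp [hα₂, hβ₂] at h₂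
  · have hα₂ : α₂ = 0 := (mul_eq_zero.mp h).resolve_left hα₁
    rw [hα₂, mul_zero, add_zero] at h'
    have hβ₂ : β₂ = 0 := (mul_eq_zero.mp h').resolve_left hα₁
    simp [hα₂, hβ₂] at h₂

theorem natDegree_sumDiff {s t u : k[X]} {n : ℕ} (hs : s.natDegree ≤ n) (ht : t.natDegree ≤ n)
    (hu : u.natDegree ≤ n) :
    (((W.map Polynomial.C).sumDiffProd s t u).natDegree ≤ n + n ∧
      ((W.map Polynomial.C).sumDiffProd s t u).coeff (n + n) =
        W.sumDiffProd (s.coeff n) (t.coeff n) (u.coeff n)) ∧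
    (((W.map Polynomial.C).sumDiffSum s t u).natDegree ≤ n + n ∧
      ((W.map Polynomial.C).sumDiffSum s t u).coeff (n + n) =
        W.sumDiffSum (s.coeff n) (t.coeff n) (u.coeff n)) ∧
    ((sumDiffDen s t u).natDegree ≤ n + n ∧
      (sumDiffDen s t u).coeff (n + n) =
        sumDiffDen (s.coeff n) (t.coeff n) (u.coeff n)) := by
  have e₁ : (W.map Polynomial.C).sumDiffProd s t u = s * s - Polynomial.C W.b₄ * (s * u) -
      Polynomial.C W.b₆ * (t * u) - Polynomial.C W.b₈ * (u * u) := by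
    simp only [sumDiffProd, map_b₄, map_b₆, map_b₈]; ring
  have e₂ : (W.map Polynomial.C).sumDiffSum s t u = Polynomial.C 2 * (t * s) +
      Polynomial.C W.b₂ * (s * u) + Polynomial.C W.b₄ * (t * u) + Polynomial.C W.b₆ * (u * u) := by
    simp only [sumDiffSum, map_b₂, map_b₄, map_b₆, map_ofNat]; ring
  have e₃ : sumDiffDen s t u = t * t - Polynomial.C 4 * (s * u) := by
    simp only [sumDiffDen, map_ofNat]; ring
  have hC : ∀ (c : k) {f g : k[X]}, f.natDegree ≤ n → g.natDegree ≤ n →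
      (Polynomial.C c * (f * g)).natDegree ≤ n + n := fun c f g hf hg =>
    (Polynomial.natDegree_C_mul_le _ _).trans (Polynomial.natDegree_mul_le_of_le hf hg)
  have hM : ∀ {f g : k[X]}, f.natDegree ≤ n → g.natDegree ≤ n →
      (f * g).natDegree ≤ n + n := fun hf hg => Polynomial.natDegree_mul_le_of_le hf hg
  rw [e₁, e₂, e₃]
  refine ⟨⟨?_, ?_⟩, ⟨?_, ?_⟩, ⟨?_, ?_⟩⟩
  · exact Polynomial.natDegree_sub_le_of_le (Polynomial.natDegree_sub_le_of_le
      (Polynomial.natDegree_sub_le_of_le (hM hs hs) (hC _ hs hu)) (hC _ ht hu))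
      (hC _ hu hu) |>.trans (by simp)
  · simp only [Polynomial.coeff_sub, Polynomial.coeff_C_mul, coeff_mul_add hs hs,
      coeff_mul_add hs hu, coeff_mul_add ht hu, coeff_mul_add hu hu, sumDiffProd]
    ring
  · exact Polynomial.natDegree_add_le_of_le (Polynomial.natDegree_add_le_of_le
      (Polynomial.natDegree_add_le_of_le (hC _ ht hs) (hC _ hs hu)) (hC _ ht hu))
      (hC _ hu hu) |>.trans (by simp)
  · simp only [Polynomial.coeff_add, Polynomial.coeff_C_mul, coeff_mul_add ht hs,
      coeff_mul_add hs hu, coeff_mul_add ht hu, coeff_mul_add hu hu, sumDiffSum]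
    ring
  · exact Polynomial.natDegree_sub_le_of_le (hM ht ht) (hC _ hs hu) |>.trans (by simp)
  · simp only [Polynomial.coeff_sub, Polynomial.coeff_C_mul, coeff_mul_add ht ht,
      coeff_mul_add hs hu, sumDiffDen]
    ring

variable {K : Type*} [Field K] [Algebra k K] (x : K)

variable {W} in
/-- The `x`-coordinate of `Q` is the reduced fraction `a / b` evaluated at `x`. -/
def HasXRep (Q : (W⁄K).Point) (a b : k[X]) : Prop :=
  IsCoprime a b ∧ ∃ c : K, c ≠ 0 ∧
    Q.xRep 0 = c * Polynomial.aeval x a ∧ Q.xRep 1 = c * Polynomial.aeval x b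

variable {W} in
/-- The `x`-coordinate of `Q`, as a rational function of `x`, has height `n`. -/
def HasHeight (Q : (W⁄K).Point) (n : ℕ) : Prop :=
  ∃ a b : k[X], HasXRep x Q a b ∧ IsTopDegree a b n

theorem aeval_sumDiff (s t u : k[X]) :
    Polynomial.aeval x ((W.map Polynomial.C).sumDiffProd s t u) =
        (W⁄K).sumDiffProd (Polynomial.aeval x s) (Polynomial.aeval x t) (Polynomial.aeval x u) ∧
      Polynomial.aeval x ((W.map Polynomial.C).sumDiffSum s t u) =
        (W⁄K).sumDiffSum (Polynomial.aeval x s) (Polynomial.aeval x t) (Polynomial.aeval x u) ∧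
      Polynomial.aeval x (sumDiffDen s t u) =
        sumDiffDen (Polynomial.aeval x s) (Polynomial.aeval x t) (Polynomial.aeval x u) := by
  simp [sumDiffProd, sumDiffSum, sumDiffDen, WeierstrassCurve.baseChange,
    map_ofNat (Polynomial.aeval x) 2, map_ofNat (Polynomial.aeval x) 4]

variable {W x}

theorem HasXRep.neg {Q : (W⁄K).Point} {a b : k[X]} (h : HasXRep x Q a b) :
    HasXRep x (-Q) a b := by
  simpa [HasXRep] using h

theorem HasHeight.neg {Q : (W⁄K).Point} {n : ℕ} (h : HasHeight x Q n) : HasHeight x (-Q) n := by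
  obtain ⟨a, b, h, h'⟩ := h
  exact ⟨a, b, h.neg, h'⟩

theorem hasHeight_zero : HasHeight x (0 : (W⁄K).Point) 0 :=
  ⟨1, 0, ⟨isCoprime_one_left, 1, one_ne_zero, by simp⟩, by simp [IsTopDegree]⟩

variable (hx : Transcendental k x)
include hx

theorem aeval_eq_zero_iff_of_transcendental {f : k[X]} : Polynomial.aeval x f = 0 ↔ f = 0 :=
  ⟨fun h => by_contra fun h' => hx ⟨f, h', h⟩, fun h => by rw [h, map_zero]⟩

theorem aeval_injective_of_transcendental {f g : k[X]}
    (h : Polynomial.aeval x f = Polynomial.aeval x g) : f = g := by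
  rw [← sub_eq_zero, ← aeval_eq_zero_iff_of_transcendental hx, map_sub, h, sub_self]

variable [DecidableEq K]

/-- The parallelogram law, at the level of `x`-coordinates. -/
theorem HasXRep.add [W.IsElliptic] {P Q : (W⁄K).Point} {a₁ b₁ a₂ b₂ a₄ b₄ : k[X]}
    (h₁ : HasXRep x P a₁ b₁) (h₂ : HasXRep x Q a₂ b₂) (h₄ : HasXRep x (P - Q) a₄ b₄) :
    ∃ a₃ b₃ : k[X], HasXRep x (P + Q) a₃ b₃ ∧
      a₃ * a₄ = (W.map Polynomial.C).sumDiffProd (a₁ * a₂) (a₁ * b₂ + b₁ * a₂) (b₁ * b₂) ∧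
      a₃ * b₄ + b₃ * a₄ = (W.map Polynomial.C).sumDiffSum (a₁ * a₂) (a₁ * b₂ + b₁ * a₂) (b₁ * b₂) ∧
      b₃ * b₄ = sumDiffDen (a₁ * a₂) (a₁ * b₂ + b₁ * a₂) (b₁ * b₂) := by
  obtain ⟨hc₁, c₁, hc₁0, e₁, e₁'⟩ := h₁
  obtain ⟨hc₂, c₂, hc₂0, e₂, e₂'⟩ := h₂
  obtain ⟨hc₄, c₄, hc₄0, e₄, e₄'⟩ := h₄
  have hell : (W⁄K).IsElliptic := inferInstanceAs ((W.map (algebraMap k K)).IsElliptic)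
  obtain ⟨c, hc, E₀, E₁, E₂⟩ := (W⁄K).exists_sym2x_add_sub P Q
  obtain ⟨v₀, hv₀⟩ : ∃ v, v = (W.map Polynomial.C).sumDiffProd (a₁ * a₂)
    (a₁ * b₂ + b₁ * a₂) (b₁ * b₂) := ⟨_, rfl⟩
  obtain ⟨v₁, hv₁⟩ : ∃ v, v = (W.map Polynomial.C).sumDiffSum (a₁ * a₂)
    (a₁ * b₂ + b₁ * a₂) (b₁ * b₂) := ⟨_, rfl⟩
  obtain ⟨v₂, hv₂⟩ : ∃ v, v = sumDiffDen (a₁ * a₂) (a₁ * b₂ + b₁ * a₂) (b₁ * b₂) := ⟨_, rfl⟩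
  obtain ⟨A₀, A₁, A₂⟩ := aeval_sumDiff W x (a₁ * a₂) (a₁ * b₂ + b₁ * a₂) (b₁ * b₂)
  rw [← hv₀, ← hv₁, ← hv₂]
  rw [← hv₀] at A₀
  rw [← hv₁] at A₁
  rw [← hv₂] at A₂
  have hC : ∃ d : K, d ≠ 0 ∧
      Polynomial.aeval x v₀ = d * ((P + Q).xRep 0 * Polynomial.aeval x a₄) ∧
      Polynomial.aeval x v₁ =
        d * ((P + Q).xRep 0 * Polynomial.aeval x b₄ + (P + Q).xRep 1 * Polynomial.aeval x a₄) ∧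
      Polynomial.aeval x v₂ = d * ((P + Q).xRep 1 * Polynomial.aeval x b₄) := by
    refine ⟨c * c₄ / (c₁ * c₂) ^ 2, by positivity, ?_, ?_, ?_⟩
    all_goals
      field_simp
    · rw [A₀]
      rw [e₁, e₁', e₂, e₂', e₄] at E₀
      simp only [sumDiffProd, map_mul, map_add] at E₀ ⊢
      linear_combination -E₀
    · rw [A₁]
      rw [e₁, e₁', e₂, e₂', e₄, e₄'] at E₁
      simp only [sumDiffSum, map_mul, map_add] at E₁ ⊢
      linear_combination -E₁
    · rw [A₂]
      rw [e₁, e₁', e₂, e₂', e₄'] at E₂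
      simp only [sumDiffDen, map_mul, map_add] at E₂ ⊢
      linear_combination -E₂
  obtain ⟨d, hd, D₀, D₁, D₂⟩ := hC
  have hrel : a₄ ^ 2 * v₂ - a₄ * b₄ * v₁ + b₄ ^ 2 * v₀ = 0 := by
    rw [← aeval_eq_zero_iff_of_transcendental hx]
    simp only [map_add, map_sub, map_mul, map_pow, D₀, D₁, D₂]
    ring
  obtain ⟨m, n, hmn⟩ := hc₄
  obtain ⟨r, hr⟩ : ∃ r, r = n * (2 * v₀ * b₄ * m - v₁ * (a₄ * m - b₄ * n) - 2 * v₂ * a₄ * n) +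
    a₄ * (v₀ * m ^ 2 + v₁ * n * m + v₂ * n ^ 2) := ⟨_, rfl⟩
  obtain ⟨w, hw⟩ : ∃ w, w = -(m * (2 * v₀ * b₄ * m - v₁ * (a₄ * m - b₄ * n) - 2 * v₂ * a₄ * n) -
    b₄ * (v₀ * m ^ 2 + v₁ * n * m + v₂ * n ^ 2)) := ⟨_, rfl⟩
  have R₀ : r * a₄ = v₀ := by
    rw [hr]
    linear_combination v₀ * (m * a₄ + n * b₄ + 1) * hmn - n ^ 2 * hrel
  have R₁ : r * b₄ + w * a₄ = v₁ := by
    rw [hr, hw]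
    linear_combination v₁ * (m * a₄ + n * b₄ + 1) * hmn + 2 * n * m * hrel
  have R₂ : w * b₄ = v₂ := by
    rw [hw]
    linear_combination v₂ * (m * a₄ + n * b₄ + 1) * hmn - m ^ 2 * hrel
  refine ⟨r, w, ⟨?_, ?_⟩, R₀, R₁, R₂⟩
  · rw [← Ideal.isCoprime_span_singleton_iff, Ideal.isCoprime_iff_sup_eq]
    by_contra hne
    obtain ⟨M, hM, hle⟩ := Ideal.exists_le_maximal _ hne
    have hrM : r ∈ M := hle (Ideal.mem_sup_left (Ideal.mem_span_singleton_self r))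
    have hwM : w ∈ M := hle (Ideal.mem_sup_right (Ideal.mem_span_singleton_self w))
    let _ := Ideal.Quotient.field M
    have q : ∀ f, f ∈ M ↔ Ideal.Quotient.mk M f = 0 := fun f => Ideal.Quotient.eq_zero_iff_mem.symm
    have hnd := ((W.map Polynomial.C).map (Ideal.Quotient.mk M)).sumDiff_nondegenerate
      (s := Ideal.Quotient.mk M (a₁ * a₂)) (t := Ideal.Quotient.mk M (a₁ * b₂ + b₁ * a₂))
      (u := Ideal.Quotient.mk M (b₁ * b₂))
    have z₀ : Ideal.Quotient.mk M v₀ = 0 := (q _).mp (R₀ ▸ M.mul_mem_right _ hrM)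
    have z₁ : Ideal.Quotient.mk M v₁ = 0 :=
      (q _).mp (R₁ ▸ M.add_mem (M.mul_mem_right _ hrM) (M.mul_mem_right _ hwM))
    have z₂ : Ideal.Quotient.mk M v₂ = 0 := (q _).mp (R₂ ▸ M.mul_mem_right _ hwM)
    have hcop : ∀ {f g : k[X]}, IsCoprime f g →
        Ideal.Quotient.mk M f ≠ 0 ∨ Ideal.Quotient.mk M g ≠ 0 := by
      rintro f g ⟨i, j, hij⟩
      by_contra! h
      have := congrArg (Ideal.Quotient.mk M) hij
      simp [h.1, h.2] at this
    have h3 := hnd (by rw [← z₀, hv₀]; simp [sumDiffProd])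
      (by rw [← z₁, hv₁]; simp [sumDiffSum, map_ofNat (Ideal.Quotient.mk M) 2])
      (by rw [← z₂, hv₂]; simp [sumDiffDen, map_ofNat (Ideal.Quotient.mk M) 4])
    simp only [map_mul, map_add] at h3
    exact symm_ne_zero (hcop hc₁) (hcop hc₂) h3
  · refine ⟨d⁻¹, inv_ne_zero hd, ?_⟩
    have S₀ := congrArg (Polynomial.aeval x) R₀
    have S₁ := congrArg (Polynomial.aeval x) R₁
    have S₂ := congrArg (Polynomial.aeval x) R₂
    have S := congrArg (Polynomial.aeval x) hmn
    simp only [map_mul, map_add, map_one, D₀, D₁, D₂] at S₀ S₁ S₂ S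
    rw [eq_inv_mul_iff_mul_eq₀ hd, eq_inv_mul_iff_mul_eq₀ hd]
    by_cases hb : Polynomial.aeval x b₄ = 0
    · have ha : Polynomial.aeval x a₄ ≠ 0 := by
        rintro ha
        simp [ha, hb] at S
      constructor
      · apply mul_right_cancel₀ ha; linear_combination -S₀
      · apply mul_right_cancel₀ ha; rw [hb] at S₁; linear_combination -S₁
    · have : d * (P + Q).xRep 1 = Polynomial.aeval x w := by
        apply mul_right_cancel₀ hb; linear_combination -S₂
      refine ⟨?_, this⟩
      apply mul_right_cancel₀ hb; linear_combination -S₁ - Polynomial.aeval x a₄ * this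

theorem HasHeight.add [W.IsElliptic] {P Q : (W⁄K).Point} {l m n : ℕ}
    (h₁ : HasHeight x P l) (h₂ : HasHeight x Q m) (h₄ : HasHeight x (P - Q) n) :
    ∃ i, HasHeight x (P + Q) i ∧ i + n = 2 * l + 2 * m := by
  obtain ⟨a₁, b₁, h₁, ha₁, hb₁, t₁⟩ := h₁
  obtain ⟨a₂, b₂, h₂, ha₂, hb₂, t₂⟩ := h₂
  obtain ⟨a₄, b₄, h₄, ha₄, hb₄, t₄⟩ := h₄
  obtain ⟨a₃, b₃, h₃, E₀, E₁, E₂⟩ := h₁.add hx h₂ h₄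
  obtain ⟨i, hi⟩ := exists_isTopDegree h₃.1
  refine ⟨i, ⟨a₃, b₃, h₃, hi⟩, ?_⟩
  obtain ⟨ha₃, hb₃, t₃⟩ := hi
  have hst := symm_ne_zero t₁ t₂
  have hst' := symm_ne_zero t₃ t₄
  have hs := Polynomial.natDegree_mul_le_of_le ha₁ ha₂
  have hu := Polynomial.natDegree_mul_le_of_le hb₁ hb₂
  have ht := natDegree_symm ha₁ hb₁ ha₂ hb₂
  have hs' := Polynomial.natDegree_mul_le_of_le ha₃ ha₄
  have hu' := Polynomial.natDegree_mul_le_of_le hb₃ hb₄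
  have ht' := natDegree_symm ha₃ hb₃ ha₄ hb₄
  obtain ⟨⟨d₀, k₀⟩, ⟨d₁, k₁⟩, ⟨d₂, k₂⟩⟩ := natDegree_sumDiff W hs ht.1 hu
  rw [← E₀] at d₀ k₀
  rw [← E₁] at d₁ k₁
  rw [← E₂] at d₂ k₂
  rw [coeff_mul_add ha₁ ha₂, ht.2, coeff_mul_add hb₁ hb₂] at k₀ k₁ k₂
  rw [← coeff_mul_add ha₃ ha₄, ← coeff_mul_add hb₃ hb₄, ← ht'.2] at hst'
  have hnd : ¬ ((a₃ * a₄).coeff (l + m + (l + m)) = 0 ∧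
      (a₃ * b₄ + b₃ * a₄).coeff (l + m + (l + m)) = 0 ∧
      (b₃ * b₄).coeff (l + m + (l + m)) = 0) := by
    rw [k₀, k₁, k₂]
    exact fun h => hst (W.sumDiff_nondegenerate h.1 h.2.1 h.2.2)
  have z : ∀ {f : k[X]} {n N : ℕ}, f.natDegree ≤ n → n < N → f.coeff N = 0 :=
    fun h h' => Polynomial.coeff_eq_zero_of_natDegree_lt (h.trans_lt h')
  obtain h | h | h := lt_trichotomy (i + n) (l + m + (l + m))
  · exact absurd ⟨z hs' h, z ht'.1 h, z hu' h⟩ hnd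
  · omega
  · exact absurd ⟨z d₀ h, z d₁ h, z d₂ h⟩ hst'

end Height

section Frobenius

open scoped Polynomial WeierstrassCurve.Affine

variable {k : Type*} [Field k] (W : Affine k)

/-- The polynomial in `x` giving the power sum `yⁿ + (-y - a₁x - a₃)ⁿ`. -/
noncomputable def powerSum : ℕ → k[X]
  | 0 => 2
  | 1 => -(Polynomial.C W.a₁ * Polynomial.X + Polynomial.C W.a₃)
  | n + 2 => -(Polynomial.C W.a₁ * Polynomial.X + Polynomial.C W.a₃) * powerSum (n + 1) +
      (Polynomial.X ^ 3 + Polynomial.C W.a₂ * Polynomial.X ^ 2 + Polynomial.C W.a₄ * Polynomial.X +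
        Polynomial.C W.a₆) * powerSum n

theorem aeval_powerSum {A : Type*} [CommRing A] [Algebra k A] {X Y : A}
    (h : (W⁄A).Equation X Y) (n : ℕ) :
    Polynomial.aeval X (W.powerSum n) = Y ^ n + (W⁄A).negY X Y ^ n := by
  rw [Affine.equation_iff] at h
  simp only [Affine.baseChange_a₁, Affine.baseChange_a₂, Affine.baseChange_a₃,
    Affine.baseChange_a₄, Affine.baseChange_a₆] at h
  induction n using Nat.twoStepInduction with
  | zero => simp [powerSum, map_ofNat (Polynomial.aeval X) 2]; norm_num
  | one => simp [powerSum, Affine.negY]; ring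
  | more n ih₁ ih₂ =>
    rw [powerSum, map_add, map_mul, map_mul, ih₁, ih₂]
    simp only [map_neg, map_add, map_mul, Polynomial.aeval_C, Polynomial.aeval_X, map_pow,
      Affine.negY, Affine.baseChange_a₁, Affine.baseChange_a₃]
    linear_combination (-(Y ^ n + (-Y - algebraMap k A W.a₁ * X - algebraMap k A W.a₃) ^ n)) * h

/-- The numerator of `x(P + Q)` over `(x(P) - x(Q))²`. -/
def addNum {R : Type*} [CommRing R] (W : Affine R) (x₁ y₁ x₂ y₂ : R) : R :=
  (x₁ + x₂) * (x₁ * x₂ + W.a₄) + 2 * W.a₂ * x₁ * x₂ + 2 * W.a₆ +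
    (y₁ * W.negY x₂ y₂ + W.negY x₁ y₁ * y₂)

theorem addNum_eq {R : Type*} [CommRing R] (W : Affine R) {x₁ y₁ x₂ y₂ : R}
    (h₁ : W.Equation x₁ y₁) (h₂ : W.Equation x₂ y₂) :
    W.addNum x₁ y₁ x₂ y₂ = (y₁ - y₂) ^ 2 + W.a₁ * (y₁ - y₂) * (x₁ - x₂) -
      (W.a₂ + x₁ + x₂) * (x₁ - x₂) ^ 2 := by
  rw [Affine.equation_iff] at h₁ h₂
  rw [addNum, Affine.negY, Affine.negY]
  linear_combination -h₁ - h₂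

theorem mul_addX_eq_addNum {F : Type*} [Field F] [DecidableEq F] (W : Affine F) {x₁ y₁ x₂ y₂ : F}
    (h₁ : W.Equation x₁ y₁) (h₂ : W.Equation x₂ y₂) (hx : x₁ ≠ x₂) :
    (x₁ - x₂) ^ 2 * W.addX x₁ x₂ (W.slope x₁ x₂ y₁ y₂) = W.addNum x₁ y₁ x₂ y₂ := by
  have hd : x₁ - x₂ ≠ 0 := sub_ne_zero.mpr hx
  rw [addNum_eq W h₁ h₂, Affine.slope_of_X_ne hx, Affine.addX]
  field_simp
  ring

/-- The numerator of `x(P + φ(P))` over `(x - x^q)²`, where `φ` is the `q`-power map. -/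
noncomputable def addFrobNum (q : ℕ) : k[X] :=
  (Polynomial.X + Polynomial.X ^ q) * (Polynomial.X ^ (q + 1) + Polynomial.C W.a₄) +
    2 * Polynomial.C W.a₂ * Polynomial.X ^ (q + 1) + 2 * Polynomial.C W.a₆ +
    (W.powerSum 1 * W.powerSum q - W.powerSum (q + 1))

/-- The numerator of `x(P - φ(P))` over `(x - x^q)²`, where `φ` is the `q`-power map. -/
noncomputable def subFrobNum (q : ℕ) : k[X] :=
  (Polynomial.X + Polynomial.X ^ q) * (Polynomial.X ^ (q + 1) + Polynomial.C W.a₄) +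
    2 * Polynomial.C W.a₂ * Polynomial.X ^ (q + 1) + 2 * Polynomial.C W.a₆ + W.powerSum (q + 1)

theorem aeval_algebraMap_eq_zero {A : Type*} [Field A] [Algebra k A] (f : k[X]) (ξ : k) :
    Polynomial.aeval (algebraMap k A ξ) f = 0 ↔ f.eval ξ = 0 := by
  rw [Polynomial.aeval_algebraMap_apply, Polynomial.coe_aeval_eq_eval,
    map_eq_zero_iff _ (algebraMap k A).injective]

variable [Fintype k]

theorem negY_pow_card {A : Type*} [CommRing A] [Algebra k A] (X Y : A) :
    (W⁄A).negY X Y ^ Fintype.card k = (W⁄A).negY (X ^ Fintype.card k) (Y ^ Fintype.card k) := by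
  have := FiniteField.coe_frobeniusAlgHom k A
  have h : ∀ z : A, FiniteField.frobeniusAlgHom k A z = z ^ Fintype.card k := fun z => by
    rw [this]
  simp only [Affine.negY, Affine.baseChange_a₁, Affine.baseChange_a₃, ← h, map_sub, map_neg,
    map_mul, AlgHom.commutes]

theorem equation_pow_card {A : Type*} [CommRing A] [Algebra k A] {X Y : A}
    (hXY : (W⁄A).Equation X Y) :
    (W⁄A).Equation (X ^ Fintype.card k) (Y ^ Fintype.card k) := by
  have := FiniteField.coe_frobeniusAlgHom k A
  have h : ∀ z : A, FiniteField.frobeniusAlgHom k A z = z ^ Fintype.card k := fun z => by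
    rw [this]
  rw [Affine.equation_iff] at hXY ⊢
  have := congrArg (FiniteField.frobeniusAlgHom k A) hXY
  simp only [Affine.baseChange_a₁, Affine.baseChange_a₂, Affine.baseChange_a₃,
    Affine.baseChange_a₄, Affine.baseChange_a₆, map_add, map_mul, map_pow,
    AlgHom.commutes] at this ⊢
  simpa only [h] using this

theorem aeval_addFrobNum {A : Type*} [CommRing A] [Algebra k A] {X Y : A}
    (h : (W⁄A).Equation X Y) :
    Polynomial.aeval X (W.addFrobNum (Fintype.card k)) =
      (W⁄A).addNum X Y (X ^ Fintype.card k) (Y ^ Fintype.card k) := by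
  simp only [addFrobNum, map_add, map_sub, map_mul, W.aeval_powerSum h, addNum, ← negY_pow_card,
    Polynomial.aeval_X, map_pow, Polynomial.aeval_C, map_ofNat, Affine.baseChange_a₂,
    Affine.baseChange_a₄, Affine.baseChange_a₆]
  ring

theorem aeval_subFrobNum {A : Type*} [CommRing A] [Algebra k A] {X Y : A}
    (h : (W⁄A).Equation X Y) :
    Polynomial.aeval X (W.subFrobNum (Fintype.card k)) =
      (W⁄A).addNum X Y (X ^ Fintype.card k)
        ((W⁄A).negY (X ^ Fintype.card k) (Y ^ Fintype.card k)) := by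
  simp only [subFrobNum, map_add, map_mul, W.aeval_powerSum h, addNum, ← negY_pow_card,
    Polynomial.aeval_X, map_pow, Polynomial.aeval_C, map_ofNat, Affine.baseChange_a₂,
    Affine.baseChange_a₄, Affine.baseChange_a₆, Affine.negY_negY]
  ring

/-- Over `ξ ∈ k`, the numerators of `x(P ± φ(P))` take the value `(η - η')²` or `0`, with `η`, `η'`
the two roots of the equation of `W` at `x = ξ`. -/
theorem count_roots_eq_card_fiber [DecidableEq k] {a₃ b₃ a₄ b₄ : k[X]} (h₃ : IsCoprime a₃ b₃)
    (h₄ : IsCoprime a₄ b₄) (hb : b₃ * b₄ = (Polynomial.X ^ Fintype.card k - Polynomial.X) ^ 2)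
    (hadd : W.addFrobNum (Fintype.card k) = a₃ * b₄)
    (hsub : W.subFrobNum (Fintype.card k) = a₄ * b₃) (ξ : k) :
    b₄.roots.count ξ = Nat.card {η : k // W.Equation ξ η} := by
  have hq : 1 < Fintype.card k := Fintype.one_lt_card
  have hd0 : b₃ * b₄ ≠ 0 := by
    rw [hb]
    exact pow_ne_zero 2 (FiniteField.X_pow_card_sub_X_ne_zero k hq)
  have hsum : b₃.roots.count ξ + b₄.roots.count ξ = 2 := by
    rw [← Multiset.count_add, ← Polynomial.roots_mul hd0, hb, Polynomial.roots_pow,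
      FiniteField.roots_X_pow_card_sub_X, Multiset.count_nsmul,
      Multiset.count_eq_one_of_mem Finset.univ.nodup (Finset.mem_univ_val ξ)]
  have hb₃ : b₃ ≠ 0 := left_ne_zero_of_mul hd0
  have hb₄ : b₄ ≠ 0 := right_ne_zero_of_mul hd0
  have hc₃ : b₃.eval ξ ≠ 0 → b₃.roots.count ξ = 0 := fun h => by
    rw [Multiset.count_eq_zero, Polynomial.mem_roots hb₃]; exact h
  have hc₄ : b₄.eval ξ ≠ 0 → b₄.roots.count ξ = 0 := fun h => by
    rw [Multiset.count_eq_zero, Polynomial.mem_roots hb₄]; exact h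
  have hc₃' : b₃.eval ξ = 0 → 0 < b₃.roots.count ξ := fun h => by
    rw [Multiset.count_pos, Polynomial.mem_roots hb₃]; exact h
  have hc₄' : b₄.eval ξ = 0 → 0 < b₄.roots.count ξ := fun h => by
    rw [Multiset.count_pos, Polynomial.mem_roots hb₄]; exact h
  by_cases hex : ∃ η, W.Equation ξ η
  · obtain ⟨η, hη⟩ := hex
    have hη' : (W⁄k).Equation ξ η := hη
    have hfib : ∀ y, W.Equation ξ y ↔ y = η ∨ y = W.negY ξ η := by
      intro y
      refine ⟨fun h => Affine.Y_eq_of_X_eq h hη rfl, ?_⟩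
      rintro (rfl | rfl)
      · exact hη
      · exact (Affine.equation_neg ξ η).mpr hη
    have e₃ := W.aeval_addFrobNum hη'
    have e₄ := W.aeval_subFrobNum hη'
    rw [Polynomial.coe_aeval_eq_eval, FiniteField.pow_card, FiniteField.pow_card] at e₃ e₄
    rw [addNum_eq _ hη' hη'] at e₃
    rw [addNum_eq _ hη' ((Affine.equation_neg ξ η).mpr hη')] at e₄
    rw [hadd, Polynomial.eval_mul] at e₃
    rw [hsub, Polynomial.eval_mul] at e₄
    simp only [sub_self, mul_zero, ne_eq, OfNat.ofNat_ne_zero, not_false_eq_true, zero_pow,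
      add_zero, sub_zero] at e₃ e₄
    have hcard : Nat.card {y : k // W.Equation ξ y} = ({η, W.negY ξ η} : Finset k).card := by
      rw [← Nat.card_eq_finsetCard]
      exact Nat.card_congr (Equiv.subtypeEquivRight fun y => by simp [hfib])
    rw [hcard]
    by_cases hne : η = W.negY ξ η
    · rw [← hne, Finset.pair_eq_singleton, Finset.card_singleton]
      have e₄' : Polynomial.eval ξ a₄ * Polynomial.eval ξ b₃ = 0 := by
        rw [e₄, show (W⁄k).negY ξ η = η from hne.symm, sub_self, zero_pow two_ne_zero]
      have hcop : ∀ {f g : k[X]}, IsCoprime f g → f.eval ξ = 0 → g.eval ξ ≠ 0 := by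
        rintro f g ⟨i, j, h⟩ hf hg
        simpa [hf, hg] using congrArg (Polynomial.eval ξ) h
      have hprod : b₃.eval ξ * b₄.eval ξ = 0 := by
        rw [← Polynomial.eval_mul, hb]
        simp [FiniteField.pow_card]
      have z₃ : b₃.eval ξ = 0 := by
        by_contra h
        exact hcop h₄ ((mul_eq_zero.mp e₄').resolve_right h) ((mul_eq_zero.mp hprod).resolve_left h)
      have z₄ : b₄.eval ξ = 0 := by
        by_contra h
        exact hcop h₃ ((mul_eq_zero.mp e₃).resolve_right h) z₃
      have := hc₃' z₃
      have := hc₄' z₄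
      omega
    · rw [Finset.card_pair hne]
      have : b₃.eval ξ ≠ 0 := by
        intro h
        rw [h, mul_zero] at e₄
        exact hne (sub_eq_zero.mp (pow_eq_zero_iff two_ne_zero |>.mp e₄.symm))
      have := hc₃ this
      omega
  · have hemp : IsEmpty {η : k // W.Equation ξ η} := ⟨fun η => hex ⟨η.1, η.2⟩⟩
    rw [Nat.card_of_isEmpty]
    apply hc₄
    intro h0
    let A := AlgebraicClosure k
    obtain ⟨η, hη⟩ : ∃ η : A, (W⁄A).Equation (algebraMap k A ξ) η := by
      let f : A[X] := Polynomial.X ^ 2 + Polynomial.C ((W⁄A).a₁ * algebraMap k A ξ + (W⁄A).a₃) *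
        Polynomial.X - Polynomial.C (algebraMap k A ξ ^ 3 + (W⁄A).a₂ * algebraMap k A ξ ^ 2 +
          (W⁄A).a₄ * algebraMap k A ξ + (W⁄A).a₆)
      have hf : f.degree ≠ 0 := by
        have : f.degree = 2 := by
          simp only [f]
          compute_degree!
        rw [this]
        decide
      obtain ⟨η, hη⟩ := IsAlgClosed.exists_root f hf
      refine ⟨η, ?_⟩
      rw [Affine.equation_iff]
      simp only [f, Polynomial.IsRoot.def, Polynomial.eval_sub, Polynomial.eval_add,
        Polynomial.eval_mul, Polynomial.eval_pow, Polynomial.eval_C, Polynomial.eval_X] at hη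
      linear_combination hη
    have hξ : algebraMap k A ξ ^ Fintype.card k = algebraMap k A ξ := by
      rw [← map_pow, FiniteField.pow_card]
    have hφ := W.equation_pow_card hη
    rw [hξ] at hφ
    have hnot : η ^ Fintype.card k ≠ η := by
      intro h
      obtain ⟨y, rfl⟩ : ∃ y : k, algebraMap k A y = η := by
        have hr : η ∈ ((Polynomial.X ^ Fintype.card k - Polynomial.X : k[X]).map
            (algebraMap k A)).roots := by
          rw [Polynomial.mem_roots (Polynomial.map_ne_zero
            (FiniteField.X_pow_card_sub_X_ne_zero k hq))]
          simp [h]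
        rw [← Polynomial.roots_map_of_injective_of_card_eq_natDegree (algebraMap k A).injective]
          at hr
        · obtain ⟨y, -, hy⟩ := Multiset.mem_map.mp hr
          exact ⟨y, hy⟩
        · rw [FiniteField.roots_X_pow_card_sub_X, FiniteField.X_pow_card_sub_X_natDegree_eq k hq]
          rfl
      exact hex ⟨y, (W.map_equation (algebraMap k A).injective ξ y).mp hη⟩
    have hconj := (Affine.Y_eq_of_X_eq hφ hη rfl).resolve_left hnot
    have e₃ := W.aeval_addFrobNum hη
    rw [hξ, addNum_eq _ hη hφ, hadd, map_mul,
      (aeval_algebraMap_eq_zero b₄ ξ).mpr h0, mul_zero, sub_self] at e₃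
    simp only [mul_zero, ne_eq, OfNat.ofNat_ne_zero, not_false_eq_true, zero_pow,
      add_zero, sub_zero] at e₃
    exact hnot (sub_eq_zero.mp (pow_eq_zero_iff two_ne_zero |>.mp e₃.symm)).symm

theorem natDegree_eq_card [DecidableEq k] {a₃ b₃ a₄ b₄ : k[X]} (h₃ : IsCoprime a₃ b₃)
    (h₄ : IsCoprime a₄ b₄) (hb : b₃ * b₄ = (Polynomial.X ^ Fintype.card k - Polynomial.X) ^ 2)
    (hadd : W.addFrobNum (Fintype.card k) = a₃ * b₄)
    (hsub : W.subFrobNum (Fintype.card k) = a₄ * b₃) :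
    b₄.natDegree = Nat.card {P : k × k // W.Equation P.1 P.2} := by
  have hq : 1 < Fintype.card k := Fintype.one_lt_card
  have hd0 : b₃ * b₄ ≠ 0 := by
    rw [hb]
    exact pow_ne_zero 2 (FiniteField.X_pow_card_sub_X_ne_zero k hq)
  have hdeg : b₃.natDegree + b₄.natDegree = 2 * Fintype.card k := by
    rw [← Polynomial.natDegree_mul (left_ne_zero_of_mul hd0) (right_ne_zero_of_mul hd0), hb,
      Polynomial.natDegree_pow, FiniteField.X_pow_card_sub_X_natDegree_eq k hq]
  have hroots : b₃.roots.card + b₄.roots.card = 2 * Fintype.card k := by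
    rw [← Multiset.card_add, ← Polynomial.roots_mul hd0, hb, Polynomial.roots_pow,
      FiniteField.roots_X_pow_card_sub_X, Multiset.card_nsmul]
    rfl
  have hle₃ := b₃.card_roots'
  have hle₄ := b₄.card_roots'
  have hcard : b₄.natDegree = b₄.roots.card := by omega
  rw [hcard, ← Multiset.sum_count_eq_card (s := Finset.univ) (fun _ _ => Finset.mem_univ _),
    Finset.sum_congr rfl fun ξ _ => W.count_roots_eq_card_fiber h₃ h₄ hb hadd hsub ξ,
    ← Nat.card_sigma]
  exact Nat.card_congr (Equiv.subtypeProdEquivSigmaSubtype W.Equation).symm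

end Frobenius

section FrobeniusHeight

open scoped Polynomial WeierstrassCurve.Affine

variable {k : Type*} [Field k] {W : Affine k} {K : Type*} [Field K] [Algebra k K] {x : K}

theorem exists_hasXRep_of_fraction (hx : Transcendental k x) {Q : (W⁄K).Point} {f g : k[X]} {c : K}
    (hg : g ≠ 0) (hc : c ≠ 0) (h₀ : Q.xRep 0 = c * Polynomial.aeval x f)
    (h₁ : Q.xRep 1 = c * Polynomial.aeval x g) :
    ∃ d a b, HasXRep x Q a b ∧ f = d * a ∧ g = d * b := by
  classical
  obtain ⟨a, ha⟩ := EuclideanDomain.gcd_dvd_left f g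
  obtain ⟨b, hb⟩ := EuclideanDomain.gcd_dvd_right f g
  have hd : EuclideanDomain.gcd f g ≠ 0 := fun h => hg (EuclideanDomain.gcd_eq_zero_iff.mp h).2
  refine ⟨_, a, b,
    ⟨?_, c * Polynomial.aeval x (EuclideanDomain.gcd f g), mul_ne_zero hc ?_, ?_, ?_⟩, ha, hb⟩
  · have := EuclideanDomain.gcd_eq_gcd_ab f g
    refine ⟨EuclideanDomain.gcdA f g, EuclideanDomain.gcdB f g, mul_left_cancel₀ hd ?_⟩
    linear_combination -this - EuclideanDomain.gcdA f g * ha - EuclideanDomain.gcdB f g * hb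
  · rwa [Ne, aeval_eq_zero_iff_of_transcendental hx]
  · rw [h₀, mul_assoc, ← map_mul, ← ha]
  · rw [h₁, mul_assoc, ← map_mul, ← hb]

variable [Fintype k] [DecidableEq K]

variable (W K) in
/-- The Frobenius endomorphism of the points of a curve over a finite field. -/
noncomputable def frob : (W⁄K).Point →+ (W⁄K).Point :=
  Affine.Point.map (W' := W) (FiniteField.frobeniusAlgHom k K)

theorem xRep_frob (Q : (W⁄K).Point) (i : Fin 2) :
    (frob W K Q).xRep i = Q.xRep i ^ Fintype.card k := by
  have h : ∀ z : K, FiniteField.frobeniusAlgHom k K z = z ^ Fintype.card k := fun z => by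
    rw [FiniteField.coe_frobeniusAlgHom]
  match Q with
  | 0 =>
    rw [map_zero]
    fin_cases i <;> simp [Fintype.card_ne_zero]
  | .some X Y hQ =>
    rw [frob, Affine.Point.map_some]
    fin_cases i <;> simp [h]

theorem HasHeight.frob {Q : (W⁄K).Point} {n : ℕ} (h : HasHeight x Q n) :
    HasHeight x (frob W K Q) (Fintype.card k * n) := by
  obtain ⟨a, b, ⟨hcop, c, hc, e₀, e₁⟩, ha, hb, t⟩ := h
  refine ⟨a ^ Fintype.card k, b ^ Fintype.card k, ⟨hcop.pow, c ^ Fintype.card k,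
    pow_ne_zero _ hc, ?_, ?_⟩, ?_, ?_, ?_⟩
  · rw [xRep_frob, e₀, mul_pow, map_pow]
  · rw [xRep_frob, e₁, mul_pow, map_pow]
  · exact Polynomial.natDegree_pow_le_of_le _ ha
  · exact Polynomial.natDegree_pow_le_of_le _ hb
  · rw [Polynomial.coeff_pow_of_natDegree_le ha, Polynomial.coeff_pow_of_natDegree_le hb]
    exact t.imp (pow_ne_zero _) (pow_ne_zero _)

/-- The heights of `P + φ(P)` and `P - φ(P)` for the generic point `P`. -/
theorem exists_hasXRep_add_sub_frob [W.IsElliptic] (hx : Transcendental k x) {y : K}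
    (h : (W⁄K).Nonsingular x y) :
    ∃ a₃ b₃ a₄ b₄ : k[X],
      HasXRep x (.some x y h + frob W K (.some x y h)) a₃ b₃ ∧
      HasXRep x (.some x y h - frob W K (.some x y h)) a₄ b₄ ∧
      a₃.natDegree = b₃.natDegree + 1 ∧ a₄.natDegree = b₄.natDegree + 1 ∧
      b₄.natDegree = Nat.card {P : k × k // W.Equation P.1 P.2} ∧
      b₃.natDegree + b₄.natDegree = 2 * Fintype.card k := by
  classical
  have hq : 1 < Fintype.card k := Fintype.one_lt_card
  have hfr : ∀ z : K, FiniteField.frobeniusAlgHom k K z = z ^ Fintype.card k := fun z => by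
    rw [FiniteField.coe_frobeniusAlgHom]
  have hne : x ≠ x ^ Fintype.card k := by
    intro h0
    have : Polynomial.aeval x (Polynomial.X ^ Fintype.card k - Polynomial.X : k[X]) = 0 := by
      simp [← h0]
    rw [aeval_eq_zero_iff_of_transcendental hx] at this
    exact FiniteField.X_pow_card_sub_X_ne_zero k hq this
  have hφ : (W⁄K).Nonsingular (x ^ Fintype.card k) (y ^ Fintype.card k) := by
    rw [← hfr, ← hfr]
    exact (W.baseChange_nonsingular (FiniteField.frobeniusAlgHom k K).injective ..).mpr h
  have hfP : frob W K (.some x y h) = .some _ _ hφ := by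
    rw [frob, Affine.Point.map_some]
    simp [hfr]
  have hd0 : (Polynomial.X ^ Fintype.card k - Polynomial.X : k[X]) ^ 2 ≠ 0 :=
    pow_ne_zero 2 (FiniteField.X_pow_card_sub_X_ne_zero k hq)
  have hdx : (x - x ^ Fintype.card k) ^ 2 ≠ 0 := pow_ne_zero 2 (sub_ne_zero.mpr hne)
  have hdae : Polynomial.aeval x ((Polynomial.X ^ Fintype.card k - Polynomial.X : k[X]) ^ 2) =
      (x - x ^ Fintype.card k) ^ 2 := by
    simp only [map_pow, map_sub, Polynomial.aeval_X]
    ring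
  have hrep : HasXRep x (.some x y h : (W⁄K).Point) Polynomial.X 1 :=
    ⟨isCoprime_one_right, 1, one_ne_zero, by simp, by simp⟩
  have hrepφ : HasXRep x (frob W K (.some x y h)) (Polynomial.X ^ Fintype.card k) 1 :=
    ⟨isCoprime_one_right, 1, one_ne_zero, by simp [hfP], by simp [hfP]⟩
  have hsubx : (Affine.Point.some x y h - frob W K (.some x y h)).xRep 0 *
      (x - x ^ Fintype.card k) ^ 2 = Polynomial.aeval x (W.subFrobNum (Fintype.card k)) ∧
      (Affine.Point.some x y h - frob W K (.some x y h)).xRep 1 = 1 := by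
    rw [hfP, sub_eq_add_neg (Affine.Point.some x y h), Affine.Point.neg_some,
      Affine.Point.add_of_X_ne hne, W.aeval_subFrobNum h.1,
      ← mul_addX_eq_addNum _ h.1 ((Affine.equation_neg _ _).mpr hφ.1) hne]
    simp [mul_comm]
  have haddx : (Affine.Point.some x y h + frob W K (.some x y h)).xRep 0 *
      (x - x ^ Fintype.card k) ^ 2 = Polynomial.aeval x (W.addFrobNum (Fintype.card k)) ∧
      (Affine.Point.some x y h + frob W K (.some x y h)).xRep 1 = 1 := by
    rw [hfP, Affine.Point.add_of_X_ne hne, W.aeval_addFrobNum h.1,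
      ← mul_addX_eq_addNum _ h.1 hφ.1 hne]
    simp [mul_comm]
  obtain ⟨e, a₄, b₄, h₄, hf, hg⟩ := exists_hasXRep_of_fraction hx
    (Q := .some x y h - frob W K (.some x y h)) (f := W.subFrobNum (Fintype.card k))
    (c := ((x - x ^ Fintype.card k) ^ 2)⁻¹) hd0
    (inv_ne_zero hdx) (by rw [← hsubx.1]; field_simp) (by rw [hsubx.2, hdae]; field_simp)
  obtain ⟨a₃, b₃, h₃, E₀, E₁, E₂⟩ := hrep.add hx hrepφ h₄
  have hb : b₃ * b₄ = (Polynomial.X ^ Fintype.card k - Polynomial.X) ^ 2 := by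
    rw [E₂, sumDiffDen]; ring
  have hb₃ : b₃ ≠ 0 := left_ne_zero_of_mul (hb ▸ hd0)
  have hb₄ : b₄ ≠ 0 := right_ne_zero_of_mul (hb ▸ hd0)
  have hsub : W.subFrobNum (Fintype.card k) = a₄ * b₃ := by
    apply mul_right_cancel₀ hb₄
    linear_combination b₄ * hf - a₄ * hb - a₄ * hg
  have hadd : W.addFrobNum (Fintype.card k) = a₃ * b₄ := by
    apply mul_right_cancel₀ hb₃
    obtain ⟨-, c, hc, f₀, f₁⟩ := h₃
    rw [haddx.2] at f₁
    have hb' : a₃ * (b₃ * b₄) = a₃ * (Polynomial.X ^ Fintype.card k - Polynomial.X) ^ 2 := by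
      rw [hb]
    have : W.addFrobNum (Fintype.card k) * b₃ =
        a₃ * (Polynomial.X ^ Fintype.card k - Polynomial.X) ^ 2 := by
      apply aeval_injective_of_transcendental hx
      rw [map_mul, map_mul, hdae, ← haddx.1, f₀]
      linear_combination (-(Polynomial.aeval x a₃) * (x - x ^ Fintype.card k) ^ 2) * f₁
    linear_combination this - hb'
  have hdb : b₃.natDegree + b₄.natDegree = 2 * Fintype.card k := by
    rw [← Polynomial.natDegree_mul hb₃ hb₄, hb, Polynomial.natDegree_pow,
      FiniteField.X_pow_card_sub_X_natDegree_eq k hq]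
  have hs : (Polynomial.X * Polynomial.X ^ Fintype.card k : k[X]) =
      Polynomial.X ^ (Fintype.card k + 1) := (pow_succ' _ _).symm
  rw [hs, one_mul, mul_one, one_mul] at E₀ E₁
  have ht : (Polynomial.X + Polynomial.X ^ Fintype.card k : k[X]).natDegree ≤ Fintype.card k + 1 :=
    by compute_degree; omega
  obtain ⟨⟨-, d₀⟩, ⟨d₁, d₁'⟩, -⟩ := natDegree_sumDiff W (n := Fintype.card k + 1)
    (s := Polynomial.X ^ (Fintype.card k + 1)) (t := Polynomial.X + Polynomial.X ^ Fintype.card k)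
    (u := 1) (by simp) ht (by simp)
  obtain ⟨⟨d₀', -⟩, -, -⟩ := natDegree_sumDiff W (n := Fintype.card k + 1)
    (s := Polynomial.X ^ (Fintype.card k + 1)) (t := Polynomial.X + Polynomial.X ^ Fintype.card k)
    (u := 1) (by simp) ht (by simp)
  have ht' : (Polynomial.X + Polynomial.X ^ Fintype.card k : k[X]).coeff
      (Fintype.card k + 1) = 0 := by
    rw [Polynomial.coeff_add, Polynomial.coeff_X, Polynomial.coeff_X_pow, if_neg (by omega),
      if_neg (by omega), add_zero]
  have hu' : (1 : k[X]).coeff (Fintype.card k + 1) = 0 := by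
    rw [Polynomial.coeff_one, if_neg (by omega)]
  rw [← E₀, ht', hu', Polynomial.coeff_X_pow_self] at d₀
  rw [← E₁, ht', hu', Polynomial.coeff_X_pow_self] at d₁'
  rw [← E₁] at d₁
  rw [← E₀] at d₀'
  have hc₀ : (a₃ * a₄).coeff (Fintype.card k + 1 + (Fintype.card k + 1)) ≠ 0 := by
    rw [d₀]; simp [sumDiffProd]
  have ha : a₃ * a₄ ≠ 0 := fun h0 => hc₀ (by rw [h0, Polynomial.coeff_zero])
  have hda := d₀'.antisymm (Polynomial.le_natDegree_of_ne_zero hc₀)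
  have hd1 : (a₃ * b₄ + b₃ * a₄).natDegree ≠ Fintype.card k + 1 + (Fintype.card k + 1) := by
    intro h0
    have h1 : (a₃ * b₄ + b₃ * a₄).coeff (a₃ * b₄ + b₃ * a₄).natDegree = 0 := by
      rw [h0, d₁']; simp [sumDiffSum]
    have h2 : a₃ * b₄ + b₃ * a₄ = 0 := Polynomial.leadingCoeff_eq_zero.mp h1
    rw [h2, Polynomial.natDegree_zero] at h0
    omega
  have ha₃ : a₃ ≠ 0 := left_ne_zero_of_mul ha
  have ha₄ : a₄ ≠ 0 := right_ne_zero_of_mul ha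
  rw [Polynomial.natDegree_mul ha₃ ha₄] at hda
  have m₁ := Polynomial.natDegree_mul ha₃ hb₄
  have m₂ := Polynomial.natDegree_mul hb₃ ha₄
  have heq : (a₃ * b₄).natDegree = (b₃ * a₄).natDegree := by
    by_contra hne
    obtain hlt | hlt := lt_or_gt_of_ne hne
    · rw [Polynomial.natDegree_add_eq_right_of_natDegree_lt hlt] at d₁ hd1
      omega
    · rw [Polynomial.natDegree_add_eq_left_of_natDegree_lt hlt] at d₁ hd1
      omega
  exact ⟨a₃, b₃, a₄, b₄, h₃, h₄, by omega, by omega,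
    W.natDegree_eq_card h₃.1 h₄.1 hb hadd hsub, hdb⟩

end FrobeniusHeight

section Composition

open scoped Polynomial WeierstrassCurve.Affine

variable {k : Type*} [Field k]

/-- The value at `(A, B)` of the degree `n` homogenization of `f`. -/
def homEval (f : k[X]) (n : ℕ) {R : Type*} [CommRing R] [Algebra k R] (A B : R) : R :=
  ∑ i ∈ Finset.range (n + 1), algebraMap k R (f.coeff i) * A ^ i * B ^ (n - i)

theorem map_homEval (f : k[X]) (n : ℕ) {R S : Type*} [CommRing R] [Algebra k R] [CommRing S]
    [Algebra k S] (φ : R →ₐ[k] S) (A B : R) : φ (homEval f n A B) = homEval f n (φ A) (φ B) := by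
  simp [homEval]

theorem homEval_zero_right (f : k[X]) (n : ℕ) {R : Type*} [CommRing R] [Algebra k R] (A : R) :
    homEval f n A 0 = algebraMap k R (f.coeff n) * A ^ n := by
  rw [homEval, Finset.sum_range_succ, Finset.sum_eq_zero]
  · simp
  · intro i hi
    rw [Finset.mem_range] at hi
    rw [zero_pow (by omega), mul_zero]

theorem homEval_eq_mul_aeval {f : k[X]} {n : ℕ} (hf : f.natDegree ≤ n) {L : Type*} [Field L]
    [Algebra k L] (A : L) {B : L} (hB : B ≠ 0) :
    homEval f n A B = B ^ n * Polynomial.aeval (A / B) f := by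
  rw [homEval, Polynomial.aeval_eq_sum_range' (Nat.lt_succ_of_le hf), Finset.mul_sum]
  refine Finset.sum_congr rfl fun i hi => ?_
  rw [Finset.mem_range, Nat.lt_succ_iff] at hi
  rw [Algebra.smul_def, div_pow, ← pow_sub_mul_pow B hi]
  field_simp

theorem homEval_ne_zero {f g : k[X]} {n : ℕ} (hfg : IsCoprime f g) (h : IsTopDegree f g n)
    {L : Type*} [Field L] [Algebra k L] {A B : L} (hAB : A ≠ 0 ∨ B ≠ 0) :
    homEval f n A B ≠ 0 ∨ homEval g n A B ≠ 0 := by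
  obtain ⟨hf, hg, ht⟩ := h
  by_cases hB : B = 0
  · subst hB
    have hA := hAB.resolve_right (not_not.mpr rfl)
    simpa only [homEval_zero_right, ne_eq, mul_eq_zero, pow_eq_zero_iff', hA, false_and, or_false,
      _root_.map_eq_zero] using ht
  · by_contra! h0
    rw [homEval_eq_mul_aeval hf _ hB, homEval_eq_mul_aeval hg _ hB, mul_eq_zero_iff_left
      (pow_ne_zero n hB), mul_eq_zero_iff_left (pow_ne_zero n hB)] at h0
    obtain ⟨u, v, huv⟩ := hfg
    have := congrArg (Polynomial.aeval (A / B)) huv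
    simp [h0.1, h0.2] at this

theorem natDegree_homEval (f : k[X]) (n : ℕ) {a b : k[X]} {m : ℕ} (ha : a.natDegree ≤ m)
    (hb : b.natDegree ≤ m) : (homEval f n a b).natDegree ≤ n * m ∧
      (homEval f n a b).coeff (n * m) = homEval f n (a.coeff m) (b.coeff m) := by
  have key : ∀ i ∈ Finset.range (n + 1),
      (algebraMap k k[X] (f.coeff i) * a ^ i * b ^ (n - i)).natDegree ≤ n * m ∧
      (algebraMap k k[X] (f.coeff i) * a ^ i * b ^ (n - i)).coeff (n * m) =
        f.coeff i * a.coeff m ^ i * b.coeff m ^ (n - i) := by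
    intro i hi
    rw [Finset.mem_range, Nat.lt_succ_iff] at hi
    have e : n * m = i * m + (n - i) * m := by rw [← add_mul, Nat.add_sub_cancel' hi]
    have h₁ : (algebraMap k k[X] (f.coeff i) * a ^ i).natDegree ≤ i * m :=
      (Polynomial.natDegree_C_mul_le _ _).trans (Polynomial.natDegree_pow_le_of_le i ha)
    have h₂ : (b ^ (n - i)).natDegree ≤ (n - i) * m := Polynomial.natDegree_pow_le_of_le _ hb
    refine ⟨e ▸ Polynomial.natDegree_mul_le_of_le h₁ h₂, ?_⟩
    rw [e, coeff_mul_add h₁ h₂, Polynomial.algebraMap_eq, Polynomial.coeff_C_mul,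
      Polynomial.coeff_pow_of_natDegree_le ha, Polynomial.coeff_pow_of_natDegree_le hb]
  refine ⟨Polynomial.natDegree_sum_le_of_forall_le _ _ fun i hi => (key i hi).1, ?_⟩
  rw [homEval, Polynomial.finsetSum_coeff, Finset.sum_congr rfl fun i hi => (key i hi).2, homEval]
  rfl

theorem isCoprime_homEval {f g : k[X]} {n : ℕ} (hfg : IsCoprime f g) (h : IsTopDegree f g n)
    {a b : k[X]} (hab : IsCoprime a b) : IsCoprime (homEval f n a b) (homEval g n a b) := by
  have key : ∀ {L : Type _} [Field L] [Algebra k L] (φ : k[X] →ₐ[k] L),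
      φ (homEval f n a b) ≠ 0 ∨ φ (homEval g n a b) ≠ 0 := by
    intro L _ _ φ
    rw [map_homEval, map_homEval]
    refine homEval_ne_zero hfg h ?_
    by_contra! h0
    obtain ⟨u, v, huv⟩ := hab
    have := congrArg φ huv
    simp [h0.1, h0.2] at this
  refine isCoprime_of_irreducible_dvd ?_ fun π hπ h₁ h₂ => ?_
  · rintro ⟨h₁, h₂⟩
    simpa [h₁, h₂] using key (IsScalarTower.toAlgHom k k[X] (FractionRing k[X]))
  · have : Fact (Irreducible π) := ⟨hπ⟩
    have := key (Polynomial.aeval (AdjoinRoot.root π))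
    rw [AdjoinRoot.aeval_eq, AdjoinRoot.aeval_eq, AdjoinRoot.mk_eq_zero.mpr h₁,
      AdjoinRoot.mk_eq_zero.mpr h₂] at this
    simp at this

theorem IsTopDegree.homEval {f g : k[X]} {n : ℕ} (hfg : IsCoprime f g) (h : IsTopDegree f g n)
    {a b : k[X]} {m : ℕ} (hab : IsTopDegree a b m) :
    IsTopDegree (homEval f n a b) (homEval g n a b) (n * m) := by
  obtain ⟨ha, hb, ht⟩ := hab
  have hf := natDegree_homEval f n ha hb
  have hg := natDegree_homEval g n ha hb
  refine ⟨hf.1, hg.1, ?_⟩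
  rw [hf.2, hg.2]
  exact homEval_ne_zero hfg h ht

variable {K : Type*} [Field K] [Algebra k K] {x : K} {W : Affine k}

theorem HasXRep.comp {a b : k[X]} {m n : ℕ} (hab : IsCoprime a b) (h : IsTopDegree a b m)
    (hb : Polynomial.aeval x b ≠ 0) {R : (W⁄K).Point}
    (hR : HasHeight (Polynomial.aeval x a / Polynomial.aeval x b) R n) :
    HasHeight x R (n * m) := by
  obtain ⟨f, g, ⟨hfg, c, hc, e₀, e₁⟩, ht⟩ := hR
  refine ⟨homEval f n a b, homEval g n a b, ⟨isCoprime_homEval hfg ht hab,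
    c / Polynomial.aeval x b ^ n, div_ne_zero hc (pow_ne_zero n hb), ?_, ?_⟩, ht.homEval hfg h⟩
  · rw [e₀, map_homEval, homEval_eq_mul_aeval ht.1 _ hb]
    field_simp
  · rw [e₁, map_homEval, homEval_eq_mul_aeval ht.2.1 _ hb]
    field_simp

theorem transcendental_div (hx : Transcendental k x) {a b : k[X]} (hab : b.natDegree < a.natDegree)
    (hb : b ≠ 0) : Transcendental k (Polynomial.aeval x a / Polynomial.aeval x b) := by
  rw [transcendental_iff]
  intro f hf
  by_contra hf0
  have hb' : Polynomial.aeval x b ≠ 0 := (aeval_eq_zero_iff_of_transcendental hx).not.mpr hb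
  have h0 := homEval_eq_mul_aeval le_rfl (f := f) (Polynomial.aeval x a) hb'
  rw [hf, mul_zero, ← map_homEval, aeval_eq_zero_iff_of_transcendental hx] at h0
  have h1 := (natDegree_homEval f f.natDegree le_rfl hab.le).2
  rw [h0, Polynomial.coeff_zero, Polynomial.coeff_eq_zero_of_natDegree_lt hab, homEval_zero_right,
    eq_comm, mul_eq_zero, pow_eq_zero_iff'] at h1
  obtain h1 | h1 := h1
  · exact hf0 (Polynomial.leadingCoeff_eq_zero.mp h1)
  · have := Polynomial.leadingCoeff_eq_zero.mp h1.1
    simp [this] at hab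

variable [Fintype k] [DecidableEq K] [W.IsElliptic]

/-- The heights of `P - φ(P)` and `P - φ²(P)` for the generic point `P`. -/
theorem hasHeight_sub_frob (hx : Transcendental k x) {y : K} (h : (W⁄K).Nonsingular x y) :
    HasHeight x (.some x y h - frob W K (.some x y h))
      (Nat.card {P : k × k // W.Equation P.1 P.2} + 1) := by
  obtain ⟨a₃, b₃, a₄, b₄, h₃, h₄, d₃, d₄, hN, hs⟩ := exists_hasXRep_add_sub_frob hx h
  have ha₄ : a₄ ≠ 0 := by rintro rfl; simp at d₄
  exact ⟨a₄, b₄, h₄, by omega, by omega, Or.inl (by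
    rw [← hN, ← d₄]; exact Polynomial.leadingCoeff_ne_zero.mpr ha₄)⟩

theorem hasHeight_sub_frob_frob (hx : Transcendental k x) {y : K} (h : (W⁄K).Nonsingular x y) :
    ∃ m, m + Nat.card {P : k × k // W.Equation P.1 P.2} = 2 * Fintype.card k + 1 ∧
    HasHeight x (.some x y h - frob W K (frob W K (.some x y h)))
      ((Nat.card {P : k × k // W.Equation P.1 P.2} + 1) * m) := by
  obtain ⟨a₃, b₃, a₄, b₄, h₃, h₄, d₃, d₄, hN, hs⟩ := exists_hasXRep_add_sub_frob hx h
  have ha₃ : a₃ ≠ 0 := by rintro rfl; simp at d₃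
  have hb₃ : b₃ ≠ 0 := by
    rintro rfl
    obtain ⟨hc, -⟩ := h₃
    rw [isCoprime_zero_right] at hc
    have := Polynomial.natDegree_eq_zero_of_isUnit hc
    omega
  refine ⟨a₃.natDegree, by omega, ?_⟩
  obtain ⟨hc, c, hc0, e₀, e₁⟩ := h₃
  have hb' : Polynomial.aeval x b₃ ≠ 0 := (aeval_eq_zero_iff_of_transcendental hx).not.mpr hb₃
  have hsub : (Affine.Point.some x y h - frob W K (frob W K (.some x y h)) : (W⁄K).Point) =
      (Affine.Point.some x y h + frob W K (.some x y h)) -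
        frob W K (Affine.Point.some x y h + frob W K (.some x y h)) := by
    rw [map_add]; abel
  rw [hsub]
  generalize (Affine.Point.some x y h + frob W K (.some x y h) : (W⁄K).Point) = Q at *
  match Q with
  | 0 => simp [hc0, hb'] at e₁
  | .some X Y hQ =>
    have hX : X = Polynomial.aeval x a₃ / Polynomial.aeval x b₃ := by
      simp only [Affine.Point.xRep_some, Matrix.cons_val_zero, Matrix.cons_val_one] at e₀ e₁
      rw [e₀, eq_div_iff hb']
      linear_combination (-Polynomial.aeval x a₃) * e₁
    have hXt : Transcendental k X := hX ▸ transcendental_div hx (by omega) hb₃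
    refine HasXRep.comp hc ⟨le_rfl, by omega, Or.inl (Polynomial.leadingCoeff_ne_zero.mpr ha₃)⟩
      hb' (hX ▸ hasHeight_sub_frob hXt hQ)

end Composition

section Quadratic

/-- A relation `h u a`, to be read as `q u = a` for a quadratic form `q` which is only partially
defined. -/
structure IsQuadraticRel {G : Type*} [AddCommGroup G] (h : G → ℤ → Prop) : Prop where
  zero : h 0 0
  neg {u : G} {a : ℤ} : h u a → h (-u) a
  add {u v : G} {a b c : ℤ} : h u a → h v b → h (u - v) c → h (u + v) (2 * a + 2 * b - c)

namespace IsQuadraticRel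

variable {G : Type*} [AddCommGroup G] {h : G → ℤ → Prop} (H : IsQuadraticRel h)
include H

theorem sub {u v : G} {a b c : ℤ} (ha : h u a) (hb : h v b) (hc : h (u + v) c) :
    h (u - v) (2 * a + 2 * b - c) := by
  rw [sub_eq_add_neg]
  exact H.add ha (H.neg hb) (by rwa [sub_neg_eq_add])

theorem add_nsmul {w u : G} {a b c : ℤ} (hw : h w a) (hu : h u b) (hwu : h (w + u) c) (i : ℕ) :
    h (w + (i : ℤ) • u) (a + i * (c - a - b) + b * i ^ 2) := by
  induction i using Nat.twoStepInduction with
  | zero => simpa using hw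
  | one =>
    convert hwu using 1
    · simp
    · push_cast
      ring
  | more i h₀ h₁ =>
    have := H.add h₁ hu (c := a + i * (c - a - b) + b * i ^ 2) (by
      convert h₀ using 1
      push_cast
      rw [add_smul, one_smul]
      abel)
    convert this using 1
    · push_cast
      rw [add_smul, add_smul, one_smul, two_smul]
      abel
    · push_cast
      ring

theorem add_zsmul {w u : G} {a b c : ℤ} (hw : h w a) (hu : h u b) (hwu : h (w + u) c) (i : ℤ) :
    h (w + i • u) (a + i * (c - a - b) + b * i ^ 2) := by
  obtain ⟨n, rfl | rfl⟩ := i.eq_nat_or_neg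
  · exact H.add_nsmul hw hu hwu n
  · have := H.add_nsmul hw (H.neg hu) (by rw [← sub_eq_add_neg]; exact H.sub hw hu hwu) n
    convert this using 1
    · simp
    · ring

theorem zsmul_add_zsmul {u v : G} {a b c : ℤ} (hu : h u a) (hv : h v b) (huv : h (u - v) c)
    (i j : ℤ) : h (i • u + j • v) (a * i ^ 2 + b * j ^ 2 + (a + b - c) * i * j) := by
  have hadd := H.add hu hv huv
  have h₁ := H.add_zsmul H.zero hu (by rwa [zero_add]) i
  rw [zero_add] at h₁
  have h₂ := H.add_zsmul hv hu (by rwa [add_comm]) i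
  rw [add_comm] at h₂
  have := H.add_zsmul h₁ hv h₂ j
  convert this using 1
  ring

end IsQuadraticRel

end Quadratic

section CharacteristicEquation

open scoped Polynomial WeierstrassCurve.Affine

variable {k : Type*} [Field k] {K : Type*} [Field K] [Algebra k K] {x : K} {W : Affine k}
theorem HasHeight.eq_zero_or_exists_algebraMap {Q : (W⁄K).Point} (h : HasHeight x Q 0) :
    Q = 0 ∨ ∃ (c : k) (y : K) (hy : (W⁄K).Nonsingular (algebraMap k K c) y),
      Q = .some (algebraMap k K c) y hy := by
  obtain ⟨a, b, ⟨-, c, hc, e₀, e₁⟩, ha, hb, -⟩ := h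
  match Q with
  | 0 => exact Or.inl rfl
  | .some X Y hQ =>
    right
    rw [Nat.le_zero, Polynomial.natDegree_eq_zero] at ha hb
    obtain ⟨α, rfl⟩ := ha
    obtain ⟨β, rfl⟩ := hb
    simp only [Affine.Point.xRep_some, Matrix.cons_val_zero, Matrix.cons_val_one,
      Polynomial.aeval_C] at e₀ e₁
    have hX : X = algebraMap k K (α / β) := by
      have : algebraMap k K β ≠ 0 := fun h0 => by simp [h0] at e₁
      rw [map_div₀, e₀, eq_div_iff this]
      linear_combination (-algebraMap k K α) * e₁
    subst hX
    exact ⟨_, _, hQ, rfl⟩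

variable [DecidableEq K] [W.IsElliptic]

theorem isQuadraticRel_hasHeight (hx : Transcendental k x) :
    IsQuadraticRel fun (Q : (W⁄K).Point) (a : ℤ) => ∃ n : ℕ, a = n ∧ HasHeight x Q n where
  zero := ⟨0, rfl, hasHeight_zero⟩
  neg := fun ⟨n, e, hn⟩ => ⟨n, e, hn.neg⟩
  add := by
    rintro u v _ _ _ ⟨l, rfl, hl⟩ ⟨m, rfl, hm⟩ ⟨n, rfl, hn⟩
    obtain ⟨i, hi, e⟩ := hl.add hx hm hn
    exact ⟨i, by omega, hi⟩

variable [Fintype k]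

/-- Twice the characteristic equation of the Frobenius endomorphism, evaluated at the generic
point, has height zero. -/
theorem hasHeight_frob_char (hx : Transcendental k x) {y : K} (h : (W⁄K).Nonsingular x y) {t : ℤ}
    (ht : t = Fintype.card k - Nat.card {P : k × k // W.Equation P.1 P.2}) :
    HasHeight x ((2 : ℤ) • ((Fintype.card k : ℤ) • Affine.Point.some x y h -
      t • frob W K (.some x y h) + frob W K (frob W K (.some x y h)))) 0 := by
  have H := isQuadraticRel_hasHeight (W := W) hx
  have h₀ : HasHeight x (.some x y h : (W⁄K).Point) 1 :=
    ⟨Polynomial.X, 1, ⟨isCoprime_one_right, 1, one_ne_zero, by simp, by simp⟩, by simp, by simp,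
      by simp⟩
  have h₀₁ := hasHeight_sub_frob hx h
  obtain ⟨m, hm, h₀₂⟩ := hasHeight_sub_frob_frob hx h
  have h₁ := h₀.frob
  have h₂ := h₁.frob
  have h₁₂ := h₀₁.frob
  rw [map_sub] at h₁₂
  generalize (.some x y h : (W⁄K).Point) = P at *
  generalize Fintype.card k = q at *
  generalize Nat.card {P : k × k // W.Equation P.1 P.2} = N at *
  have hu := H.zsmul_add_zsmul ⟨_, rfl, h₀⟩ ⟨_, rfl, h₁⟩ ⟨_, rfl, h₀₁⟩ q (-2 * t)
  have hv := H.zsmul_add_zsmul ⟨_, rfl, h₀⟩ ⟨_, rfl, h₂⟩ ⟨_, rfl, h₀₂⟩ q 2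
  have hw := H.zsmul_add_zsmul ⟨_, rfl, h₁⟩ ⟨_, rfl, h₂⟩ ⟨_, rfl, h₁₂⟩ (-2 * t) (-2)
  rw [show (-2 * t) • frob W K P + (-2 : ℤ) • frob W K (frob W K P) =
    ((q : ℤ) • P + (-2 * t) • frob W K P) - ((q : ℤ) • P + (2 : ℤ) • frob W K (frob W K P)) by
      module] at hw
  have := H.add hu hv hw
  obtain ⟨n, hn, hh⟩ := this
  have hm' : (m : ℤ) = 2 * q + 1 - N := by omega
  have hn0 : n = 0 := by
    zify
    rw [← hn]
    push_cast
    rw [hm', ht]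
    ring
  subst hn0
  convert hh using 1
  module

end CharacteristicEquation

section Formal

variable {A : Type*} [CommRing A] (W : WeierstrassCurve A)

/-- The equation of `W` (assuming `a₆ = 0`) in the coordinates `u = -x / y`, `w = -1 / y`. -/
def FormalEquation (u w : A) : Prop :=
  w = u ^ 3 + W.a₁ * u * w + W.a₂ * u ^ 2 * w + W.a₃ * w ^ 2 + W.a₄ * u * w ^ 2

/-- The denominator of the invariant differential in the coordinates `u, w`. -/
def formalDen (u w : A) : A :=
  1 - W.a₁ * u - W.a₂ * u ^ 2 - 2 * W.a₃ * w - 2 * W.a₄ * u * w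

/-- The quotient `u ^ 3 / w`. -/
def formalUnit (u w : A) : A :=
  1 - W.a₁ * u - W.a₂ * u ^ 2 - W.a₃ * w - W.a₄ * u * w

variable {W}

theorem FormalEquation.mul_formalUnit {u w : A} (h : W.FormalEquation u w) :
    w * W.formalUnit u w = u ^ 3 := by
  rw [FormalEquation] at h
  rw [formalUnit]
  linear_combination h

theorem FormalEquation.map {B : Type*} [CommRing B] (f : A →+* B) {u w : A}
    (h : W.FormalEquation u w) : (W.map f).FormalEquation (f u) (f w) := by
  have := congrArg f h
  simpa [FormalEquation] using this

theorem map_formalUnit {B : Type*} [CommRing B] (f : A →+* B) (u w : A) :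
    (W.map f).formalUnit (f u) (f w) = f (W.formalUnit u w) := by
  simp [formalUnit]

open scoped Polynomial in
theorem eq_zero_of_mul_eq {G T S : A[X]} {u₁ u₂ u₃ : A} (hG₁ : IsUnit (G.eval u₁))
    (hG₂ : IsUnit (G.eval u₂)) (hG₃ : IsUnit (G.eval u₃)) (hT : T.natDegree ≤ 2)
    (h : G * T = (Polynomial.X - Polynomial.C u₁) * (Polynomial.X - Polynomial.C u₂) *
      (Polynomial.X - Polynomial.C u₃) * S) : T = 0 := by
  have key : ∀ u : A, IsUnit (G.eval u) → IsCoprime (Polynomial.X - Polynomial.C u) G := by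
    rintro u ⟨v, hv⟩
    obtain ⟨r, hr⟩ := Polynomial.X_sub_C_dvd_sub_C_eval (a := u) (p := G)
    refine ⟨-Polynomial.C (↑v⁻¹ : A) * r, Polynomial.C (↑v⁻¹ : A), ?_⟩
    have : Polynomial.C (↑v⁻¹ : A) * Polynomial.C (G.eval u) = 1 := by
      rw [← hv, ← Polynomial.C_mul, Units.inv_mul, Polynomial.C_1]
    linear_combination Polynomial.C (↑v⁻¹ : A) * hr + this
  have hd := (((key u₁ hG₁).mul_left (key u₂ hG₂)).mul_left (key u₃ hG₃)).dvd_of_dvd_mul_left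
    (Dvd.intro _ h.symm)
  have hm := ((Polynomial.monic_X_sub_C u₁).mul (Polynomial.monic_X_sub_C u₂)).mul
    (Polynomial.monic_X_sub_C u₃)
  by_contra hT0
  have : Nontrivial A := by
    by_contra hA
    rw [not_nontrivial_iff_subsingleton] at hA
    exact hT0 (Subsingleton.elim _ _)
  refine hm.not_dvd_of_natDegree_lt hT0 ?_ hd
  rw [((Polynomial.monic_X_sub_C u₁).mul (Polynomial.monic_X_sub_C u₂)).natDegree_mul
    (Polynomial.monic_X_sub_C u₃), (Polynomial.monic_X_sub_C u₁).natDegree_mul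
    (Polynomial.monic_X_sub_C u₂)]
  simp only [Polynomial.natDegree_X_sub_C]
  omega

variable (W) in
/-- The line `w = l * u + n` meets the curve in the points `(u₁, w₁)`, `(u₂, w₂)`, `(u₃, w₃)`,
counted with multiplicity. -/
structure IsLineTriple (l n u₁ w₁ u₂ w₂ u₃ w₃ : A) : Prop where
  line₁ : w₁ = l * u₁ + n
  line₂ : w₂ = l * u₂ + n
  line₃ : w₃ = l * u₃ + n
  sum : (1 + W.a₂ * l + W.a₄ * l ^ 2) * (u₁ + u₂ + u₃) =
    -(W.a₁ * l + W.a₂ * n + W.a₃ * l ^ 2 + 2 * W.a₄ * l * n)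
  sum_mul : (1 + W.a₂ * l + W.a₄ * l ^ 2) * (u₁ * u₂ + u₁ * u₃ + u₂ * u₃) =
    W.a₁ * n + 2 * W.a₃ * l * n + W.a₄ * n ^ 2 - l
  prod : (1 + W.a₂ * l + W.a₄ * l ^ 2) * (u₁ * u₂ * u₃) = n - W.a₃ * n ^ 2

namespace IsLineTriple

variable {l n u₁ w₁ u₂ w₂ u₃ w₃ : A}

theorem rotate (h : W.IsLineTriple l n u₁ w₁ u₂ w₂ u₃ w₃) :
    W.IsLineTriple l n u₂ w₂ u₃ w₃ u₁ w₁ where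
  line₁ := h.line₂
  line₂ := h.line₃
  line₃ := h.line₁
  sum := by linear_combination h.sum
  sum_mul := by linear_combination h.sum_mul
  prod := by linear_combination h.prod

theorem map {B : Type*} [CommRing B] (f : A →+* B) (h : W.IsLineTriple l n u₁ w₁ u₂ w₂ u₃ w₃) :
    (W.map f).IsLineTriple (f l) (f n) (f u₁) (f w₁) (f u₂) (f w₂) (f u₃) (f w₃) where
  line₁ := by simpa using congrArg f h.line₁
  line₂ := by simpa using congrArg f h.line₂
  line₃ := by simpa using congrArg f h.line₃
  sum := by simpa [map_ofNat f 2] using congrArg f h.sum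
  sum_mul := by simpa [map_ofNat f 2] using congrArg f h.sum_mul
  prod := by simpa using congrArg f h.prod

theorem formalEquation₁ (h : W.IsLineTriple l n u₁ w₁ u₂ w₂ u₃ w₃) : W.FormalEquation u₁ w₁ := by
  rw [FormalEquation, h.line₁]
  linear_combination (-u₁ ^ 2) * h.sum + u₁ * h.sum_mul - h.prod

theorem formalEquation₂ (h : W.IsLineTriple l n u₁ w₁ u₂ w₂ u₃ w₃) : W.FormalEquation u₂ w₂ :=
  h.rotate.formalEquation₁

theorem formalEquation₃ (h : W.IsLineTriple l n u₁ w₁ u₂ w₂ u₃ w₃) : W.FormalEquation u₃ w₃ :=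
  h.rotate.rotate.formalEquation₁

theorem mul_mul_eq (h : W.IsLineTriple l n u₁ w₁ u₂ w₂ u₃ w₃) :
    (1 + W.a₂ * l + W.a₄ * l ^ 2) * (w₁ * w₂ * w₃) = n ^ 3 := by
  rw [h.line₁, h.line₂, h.line₃]
  linear_combination l ^ 3 * h.prod + l ^ 2 * n * h.sum_mul + l * n ^ 2 * h.sum

set_option maxRecDepth 4000 in
/-- The invariant differentials at three collinear points sum to zero. -/
theorem sum_omega_eq_zero {R : Type*} [CommRing R] [Algebra R A]
    (h : W.IsLineTriple l n u₁ w₁ u₂ w₂ u₃ w₃) (D : Derivation R A A)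
    (h₁ : D W.a₁ = 0) (h₂ : D W.a₂ = 0) (h₃ : D W.a₃ = 0) (h₄ : D W.a₄ = 0)
    (hM : IsUnit (1 + W.a₂ * l + W.a₄ * l ^ 2))
    (hG₁ : IsUnit (W.formalDen u₁ w₁)) (hG₂ : IsUnit (W.formalDen u₂ w₂))
    (hG₃ : IsUnit (W.formalDen u₃ w₃)) {ω₁ ω₂ ω₃ : A} (hω₁ : W.formalDen u₁ w₁ * ω₁ = D u₁)
    (hω₂ : W.formalDen u₂ w₂ * ω₂ = D u₂) (hω₃ : W.formalDen u₃ w₃ * ω₃ = D u₃) :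
    ω₁ + ω₂ + ω₃ = 0 := by
  have two : D 2 = 0 := by simpa using D.map_natCast 2
  have e₁ := congrArg D h.sum
  have e₂ := congrArg D h.sum_mul
  have e₃ := congrArg D h.prod
  simp only [Derivation.leibniz, Derivation.leibniz_pow, map_add, map_neg, map_sub, smul_eq_mul,
    Derivation.map_one_eq_zero, h₁, h₂, h₃, h₄, two, nsmul_eq_mul,
    Nat.cast_ofNat] at e₁ e₂ e₃
  set M := 1 + W.a₂ * l + W.a₄ * l ^ 2 with hMdef
  set c : A →+* Polynomial A := Polynomial.C with hc
  set X : Polynomial A := Polynomial.X with hX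
  have hT := eq_zero_of_mul_eq (u₁ := u₁) (u₂ := u₂) (u₃ := u₃)
    (G := c (1 - 2 * W.a₃ * n) + c (-W.a₁ - 2 * W.a₃ * l - 2 * W.a₄ * n) * X +
      c (-W.a₂ - 2 * W.a₄ * l) * X ^ 2)
    (T := c (-M * (ω₁ + ω₂ + ω₃)) * X ^ 2 +
      c (D l + M * (ω₁ * (u₂ + u₃) + ω₂ * (u₁ + u₃) + ω₃ * (u₁ + u₂))) * X +
      c (D n - M * (ω₁ * u₂ * u₃ + ω₂ * u₁ * u₃ + ω₃ * u₁ * u₂)))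
    (S := -c (D l * W.a₂ + 2 * W.a₄ * l * D l) -
      c M *
        (c ω₁ * (c (-W.a₁ - 2 * W.a₃ * l - 2 * W.a₄ * n) + c (-W.a₂ - 2 * W.a₄ * l) * (X + c u₁))
        + c ω₂ * (c (-W.a₁ - 2 * W.a₃ * l - 2 * W.a₄ * n) + c (-W.a₂ - 2 * W.a₄ * l) * (X + c u₂))
        + c ω₃ * (c (-W.a₁ - 2 * W.a₃ * l - 2 * W.a₄ * n) + c (-W.a₂ - 2 * W.a₄ * l) * (X + c u₃))))
    ?_ ?_ ?_ ?_ ?_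
  · have := congrArg (Polynomial.coeff · 2) hT
    simp only [hX, hc, Polynomial.coeff_add, Polynomial.coeff_C_mul, Polynomial.coeff_X_pow_self,
      Polynomial.coeff_X_of_ne_one (show 2 ≠ 1 by decide), Polynomial.coeff_zero,
      Polynomial.coeff_C_of_ne_zero (show 2 ≠ 0 by decide), mul_one, mul_zero, add_zero] at this
    rwa [hM.neg.mul_right_eq_zero] at this
  · convert hG₁ using 1
    rw [formalDen, h.line₁]
    simp [hc, hX]
    ring
  · convert hG₂ using 1
    rw [formalDen, h.line₂]
    simp [hc, hX]
    ring
  · convert hG₃ using 1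
    rw [formalDen, h.line₃]
    simp [hc, hX]
    ring
  · exact Polynomial.natDegree_quadratic_le
  · have c2 : c 2 = 2 := map_ofNat c 2
    rw [formalDen, h.line₁] at hω₁
    rw [formalDen, h.line₂] at hω₂
    rw [formalDen, h.line₃] at hω₃
    apply_fun c at e₁ e₂ e₃ hω₁ hω₂ hω₃
    simp only [hMdef, map_add, map_sub, map_mul, map_neg, map_one, map_pow, c2, mul_zero,
      add_zero, zero_add, Nat.reduceSub, pow_one] at e₁ e₂ e₃ hω₁ hω₂ hω₃ ⊢
    linear_combination -X ^ 2 * e₁ + X * e₂ - e₃ -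
      (1 + c W.a₂ * c l + c W.a₄ * c l ^ 2) * ((X - c u₂) * (X - c u₃) * hω₁ +
        (X - c u₁) * (X - c u₃) * hω₂ + (X - c u₁) * (X - c u₂) * hω₃)

end IsLineTriple

end Formal

section FormalPoint

variable {K : Type*} [Field K] {W : Affine K}

theorem FormalEquation.equation {u w : K} (h : FormalEquation W u w) (h₆ : W.a₆ = 0) (hw : w ≠ 0) :
    W.Equation (u / w) (-1 / w) := by
  rw [FormalEquation] at h
  rw [Affine.equation_iff, h₆]
  field_simp
  linear_combination h

open Classical in
variable (W) in
/-- The point of `W` with coordinates `-x / y = u` and `-1 / y = w`. -/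
noncomputable def formalPoint (u w : K) : W.Point :=
  if h : w ≠ 0 ∧ W.Nonsingular (u / w) (-1 / w) then .some _ _ h.2 else 0

@[simp]
theorem formalPoint_zero_right (u : K) : formalPoint W u 0 = 0 := by
  rw [formalPoint, dif_neg (by simp)]

theorem FormalEquation.formalPoint_of_ne [W.IsElliptic] {u w : K} (h : FormalEquation W u w)
    (h₆ : W.a₆ = 0) (hw : w ≠ 0) :
    formalPoint W u w =
      .some (u / w) (-1 / w) (W.equation_iff_nonsingular.mp (h.equation h₆ hw)) := by
  rw [formalPoint, dif_pos ⟨hw, W.equation_iff_nonsingular.mp (h.equation h₆ hw)⟩]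

variable [DecidableEq K] {l n u₁ w₁ u₂ w₂ u₃ w₃ : K}

theorem some_add_some_of_line {X₁ Y₁ X₂ Y₂ X₃ Y₃ s m : K} (h₁ : W.Nonsingular X₁ Y₁)
    (h₂ : W.Nonsingular X₂ Y₂) (h₃ : W.Nonsingular X₃ (W.negY X₃ Y₃)) (y₁ : Y₁ = s * X₁ + m)
    (y₂ : Y₂ = s * X₂ + m) (y₃ : Y₃ = s * X₃ + m)
    (hx : X₁ + X₂ + X₃ = s ^ 2 + W.a₁ * s - W.a₂)
    (hx₂ : X₁ * X₂ + X₁ * X₃ + X₂ * X₃ = W.a₄ - 2 * s * m - W.a₁ * m - W.a₃ * s) :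
    Affine.Point.some X₁ Y₁ h₁ + Affine.Point.some X₂ Y₂ h₂ =
      Affine.Point.some X₃ (W.negY X₃ Y₃) h₃ := by
  have hne : ¬(X₁ = X₂ ∧ Y₁ = W.negY X₂ Y₂) := by
    rintro ⟨rfl, hY⟩
    obtain rfl : Y₁ = Y₂ := by rw [y₁, y₂]
    have hns := (Affine.nonsingular_iff ..).mp h₁
    rw [Affine.negY] at hY
    refine hns.2.elim (fun h' => h' ?_) (fun h' => h' ?_)
    · rw [y₁] at hY ⊢
      linear_combination -s * hY - 2 * X₁ * hx + hx₂
    · linear_combination hY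
  have hs : W.slope X₁ X₂ Y₁ Y₂ = s := by
    by_cases hX : X₁ = X₂
    · subst hX
      obtain rfl : Y₁ = Y₂ := by rw [y₁, y₂]
      have hY : Y₁ ≠ W.negY X₁ Y₁ := fun h' => hne ⟨rfl, h'⟩
      rw [Affine.slope_of_Y_ne rfl hY, div_eq_iff (sub_ne_zero.mpr hY), Affine.negY, y₁]
      linear_combination 2 * X₁ * hx - hx₂
    · rw [Affine.slope_of_X_ne hX, div_eq_iff (sub_ne_zero.mpr hX), y₁, y₂]
      ring
  have hX₃ : W.addX X₁ X₂ s = X₃ := by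
    rw [Affine.addX]
    linear_combination -hx
  rw [Affine.Point.add_some hne, Affine.Point.some.injEq, hs]
  refine ⟨hX₃, ?_⟩
  rw [Affine.addY, Affine.negAddY, hX₃, y₃, y₁]
  congr 1
  ring

variable [W.IsElliptic]

namespace IsLineTriple

theorem formalPoint_sum_of_eq_zero (h : IsLineTriple W l n u₁ w₁ u₂ w₂ u₃ w₃) (h₆ : W.a₆ = 0)
    (hU₁ : formalUnit W u₁ w₁ ≠ 0) (hU₂ : formalUnit W u₂ w₂ ≠ 0) (h₃ : w₃ = 0)
    (hu₃ : u₃ = 0) (hM : 1 + W.a₂ * l + W.a₄ * l ^ 2 ≠ 0) :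
    formalPoint W u₁ w₁ + formalPoint W u₂ w₂ + formalPoint W u₃ w₃ = 0 := by
  have E₁ := h.formalEquation₁.mul_formalUnit
  have E₂ := h.formalEquation₂.mul_formalUnit
  have hf₁ := h.formalEquation₁
  have hf₂ := h.formalEquation₂
  obtain ⟨L₁, L₂, L₃, S₁, S₂, S₃⟩ := h
  subst h₃ hu₃
  have hn : n = 0 := by linear_combination -L₃
  subst hn
  rw [add_zero] at L₁ L₂
  rw [formalPoint_zero_right, add_zero]
  by_cases hw₁ : w₁ = 0
  · rw [hw₁, zero_mul, eq_comm, pow_eq_zero_iff three_ne_zero] at E₁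
    have hl : l = 0 := by rw [E₁] at S₂; linear_combination S₂
    rw [L₁, L₂, hl, zero_mul, zero_mul, formalPoint_zero_right, formalPoint_zero_right, add_zero]
  by_cases hw₂ : w₂ = 0
  · rw [hw₂, zero_mul, eq_comm, pow_eq_zero_iff three_ne_zero] at E₂
    have hl : l = 0 := by rw [E₂] at S₂; linear_combination S₂
    rw [L₁, L₂, hl, zero_mul, zero_mul, formalPoint_zero_right, formalPoint_zero_right, add_zero]
  rw [hf₁.formalPoint_of_ne h₆ hw₁, hf₂.formalPoint_of_ne h₆ hw₂]
  have hl : l ≠ 0 := by rintro rfl; simp at L₁; exact hw₁ L₁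
  have hu₁ : u₁ ≠ 0 := by rintro rfl; simp at L₁; exact hw₁ L₁
  have hu₂ : u₂ ≠ 0 := by rintro rfl; simp at L₂; exact hw₂ L₂
  apply Affine.Point.add_of_Y_eq
  · rw [L₁, L₂]
    field_simp
  · rw [L₁, L₂, Affine.negY]
    rw [L₁, L₂] at *
    field_simp
    apply mul_left_cancel₀ hM
    linear_combination -S₁ + (W.a₁ + W.a₃ * l) * S₂

theorem formalPoint_sum (h : IsLineTriple W l n u₁ w₁ u₂ w₂ u₃ w₃) (h₆ : W.a₆ = 0)
    (hU₁ : formalUnit W u₁ w₁ ≠ 0) (hU₂ : formalUnit W u₂ w₂ ≠ 0) (hU₃ : formalUnit W u₃ w₃ ≠ 0)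
    (hM : 1 + W.a₂ * l + W.a₄ * l ^ 2 ≠ 0) :
    formalPoint W u₁ w₁ + formalPoint W u₂ w₂ + formalPoint W u₃ w₃ = 0 := by
  have key : ∀ {u w : K}, FormalEquation W u w → w = 0 → u = 0 := fun {u w} hf hw => by
    have := hf.mul_formalUnit
    rw [hw, zero_mul, eq_comm, pow_eq_zero_iff three_ne_zero] at this
    exact this
  by_cases h₃ : w₃ = 0
  · exact h.formalPoint_sum_of_eq_zero h₆ hU₁ hU₂ h₃ (key h.formalEquation₃ h₃) hM
  by_cases h₁ : w₁ = 0
  · have := h.rotate.formalPoint_sum_of_eq_zero h₆ hU₂ hU₃ h₁ (key h.formalEquation₁ h₁) hM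
    rwa [add_comm, ← add_assoc] at this
  by_cases h₂ : w₂ = 0
  · have := h.rotate.rotate.formalPoint_sum_of_eq_zero h₆ hU₃ hU₁ h₂ (key h.formalEquation₂ h₂) hM
    rwa [add_assoc, add_comm] at this
  have hn : n ≠ 0 := by
    rintro rfl
    have := h.mul_mul_eq
    simp [hM, h₁, h₂, h₃] at this
  rw [h.formalEquation₁.formalPoint_of_ne h₆ h₁, h.formalEquation₂.formalPoint_of_ne h₆ h₂,
    h.formalEquation₃.formalPoint_of_ne h₆ h₃, ← eq_neg_iff_add_eq_zero, Affine.Point.neg_some]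
  have q₁ := h.formalEquation₁.equation h₆ h₁
  have q₂ := h.formalEquation₂.equation h₆ h₂
  have q₃ := h.formalEquation₃.equation h₆ h₃
  have hp := h.mul_mul_eq
  have hσ₁ : (1 + W.a₂ * l + W.a₄ * l ^ 2) * (u₁ * w₂ * w₃ + u₂ * w₁ * w₃ + u₃ * w₁ * w₂) =
      n * l ^ 2 + W.a₁ * l * n ^ 2 - W.a₂ * n ^ 3 := by
    rw [h.line₁, h.line₂, h.line₃]
    linear_combination 3 * l ^ 2 * h.prod + 2 * l * n * h.sum_mul + n ^ 2 * h.sum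
  have hσ₂ : (1 + W.a₂ * l + W.a₄ * l ^ 2) * (u₁ * u₂ * w₃ + u₁ * u₃ * w₂ + u₂ * u₃ * w₁) =
      n ^ 3 * W.a₄ + 2 * l * n + W.a₁ * n ^ 2 - W.a₃ * l * n ^ 2 := by
    rw [h.line₁, h.line₂, h.line₃]
    linear_combination 3 * l * h.prod + n * h.sum_mul
  have hx : u₁ / w₁ + u₂ / w₂ + u₃ / w₃ = (l / n) ^ 2 + W.a₁ * (l / n) - W.a₂ := by
    field_simp
    apply mul_left_cancel₀ hM
    linear_combination n ^ 2 * hσ₁ - (l ^ 2 + W.a₁ * l * n - W.a₂ * n ^ 2) * hp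
  have hx₂ : u₁ / w₁ * (u₂ / w₂) + u₁ / w₁ * (u₃ / w₃) + u₂ / w₂ * (u₃ / w₃) =
      W.a₄ - 2 * (l / n) * (-1 / n) - W.a₁ * (-1 / n) - W.a₃ * (l / n) := by
    field_simp
    apply mul_left_cancel₀ hM
    linear_combination n ^ 2 * hσ₂ - (n ^ 2 * W.a₄ + 2 * l + W.a₁ * n - W.a₃ * l * n) * hp
  have hy : ∀ {u w : K}, w ≠ 0 → w = l * u + n → -1 / w = l / n * (u / w) + -1 / n := by
    intro u w hw e
    field_simp
    linear_combination e
  exact some_add_some_of_line _ _ _ (hy h₁ h.line₁) (hy h₂ h.line₂) (hy h₃ h.line₃) hx hx₂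

end IsLineTriple

end FormalPoint

section PowerSeriesPoint

variable {R : Type*} [CommRing R] {W : WeierstrassCurve R⟦X⟧}

theorem isUnit_of_constantCoeff_eq_one {f : R⟦X⟧} (h : constantCoeff f = 1) : IsUnit f := by
  rw [isUnit_iff_constantCoeff, h]
  exact isUnit_one

theorem isUnit_formalDen {u w : R⟦X⟧} (hu : constantCoeff u = 0) (hw : constantCoeff w = 0) :
    IsUnit (W.formalDen u w) :=
  isUnit_of_constantCoeff_eq_one (by simp [formalDen, hu, hw])

theorem isUnit_formalUnit {u w : R⟦X⟧} (hu : constantCoeff u = 0) (hw : constantCoeff w = 0) :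
    IsUnit (W.formalUnit u w) :=
  isUnit_of_constantCoeff_eq_one (by simp [formalUnit, hu, hw])

/-- The third point of intersection of a line with the formal group of `W`. -/
theorem exists_isLineTriple {u₁ w₁ u₂ w₂ : R⟦X⟧} (h₁ : W.FormalEquation u₁ w₁)
    (h₂ : W.FormalEquation u₂ w₂) (hu₁ : constantCoeff u₁ = 0) (hw₁ : constantCoeff w₁ = 0)
    (hu₂ : constantCoeff u₂ = 0) (hw₂ : constantCoeff w₂ = 0) :
    ∃ l n u₃ w₃ : R⟦X⟧, W.IsLineTriple l n u₁ w₁ u₂ w₂ u₃ w₃ ∧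
      IsUnit (1 + W.a₂ * l + W.a₄ * l ^ 2) ∧ constantCoeff u₃ = 0 ∧ constantCoeff w₃ = 0 := by
  obtain ⟨d, hd⟩ := (isUnit_of_constantCoeff_eq_one (f := 1 - W.a₁ * u₂ - W.a₂ * u₂ ^ 2 -
    W.a₃ * (w₁ + w₂) - W.a₄ * u₂ * (w₁ + w₂))
    (by simp [hu₂, hw₁, hw₂])).exists_right_inv
  obtain ⟨N, hN⟩ : ∃ N, N = u₁ ^ 2 + u₁ * u₂ + u₂ ^ 2 + W.a₁ * w₁ + W.a₂ * (u₁ + u₂) * w₁ +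
    W.a₄ * w₁ ^ 2 := ⟨_, rfl⟩
  obtain ⟨l, hl⟩ : ∃ l, l = N * d := ⟨_, rfl⟩
  obtain ⟨n, hn⟩ : ∃ n, n = w₁ - l * u₁ := ⟨_, rfl⟩
  have hl₀ : constantCoeff l = 0 := by simp [hl, hN, hu₁, hu₂, hw₁]
  have hn₀ : constantCoeff n = 0 := by simp [hn, hu₁, hw₁]
  have hM := isUnit_of_constantCoeff_eq_one (f := 1 + W.a₂ * l + W.a₄ * l ^ 2) (by simp [hl₀])
  obtain ⟨e, he⟩ := hM.exists_right_inv
  obtain ⟨u₃, hu₃⟩ : ∃ u₃, u₃ = -u₁ - u₂ -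
    (W.a₁ * l + W.a₂ * n + W.a₃ * l ^ 2 + 2 * W.a₄ * l * n) * e := ⟨_, rfl⟩
  have hu₃₀ : constantCoeff u₃ = 0 := by simp [hu₃, hu₁, hu₂, hl₀, hn₀]
  have hDl : (1 - W.a₁ * u₂ - W.a₂ * u₂ ^ 2 - W.a₃ * (w₁ + w₂) - W.a₄ * u₂ * (w₁ + w₂)) * l =
      N := by
    rw [hl]
    linear_combination N * hd
  have L₁ : w₁ = l * u₁ + n := by rw [hn]; ring
  rw [FormalEquation] at h₁ h₂
  have L₂ : w₂ = l * u₂ + n := by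
    have : w₁ - w₂ = l * (u₁ - u₂) := by
      rw [hl]
      linear_combination d * (h₁ - h₂) - (w₁ - w₂) * hd - d * (u₁ - u₂) * hN
    linear_combination L₁ - this
  have hsum : (1 + W.a₂ * l + W.a₄ * l ^ 2) * (u₁ + u₂ + u₃) =
      -(W.a₁ * l + W.a₂ * n + W.a₃ * l ^ 2 + 2 * W.a₄ * l * n) := by
    rw [hu₃]
    linear_combination
      -(W.a₁ * l + W.a₂ * n + W.a₃ * l ^ 2 + 2 * W.a₄ * l * n) * he
  have hsm : (1 + W.a₂ * l + W.a₄ * l ^ 2) * (u₁ * u₂ + u₁ * u₃ + u₂ * u₃) =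
      W.a₁ * n + 2 * W.a₃ * l * n + W.a₄ * n ^ 2 - l := by
    rw [hN, L₁, L₂] at hDl
    linear_combination (u₁ + u₂) * hsum + hDl
  refine ⟨l, n, u₃, l * u₃ + n, ⟨L₁, L₂, rfl, hsum, hsm, ?_⟩, hM, hu₃₀, by simp [hu₃₀, hn₀]⟩
  rw [L₁] at h₁
  linear_combination (-u₁ ^ 2) * hsum + u₁ * hsm - h₁

end PowerSeriesPoint

section FormalSubgroup

variable {R : Type*} [CommRing R] {K : Type*} [Field K]

/-- `P` is the image of a point `(u, w)` of the formal group of `W` at which the invariant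
differential is `c`. -/
def IsFormalPair (W : WeierstrassCurve R⟦X⟧) (ρ : R⟦X⟧ →+* K) (V : Affine K) (c : R⟦X⟧)
    (P : V.Point) : Prop :=
  ∃ u w : R⟦X⟧, constantCoeff u = 0 ∧ constantCoeff w = 0 ∧ W.FormalEquation u w ∧
    W.formalDen u w * c = d⁄dX R u ∧ P = formalPoint V (ρ u) (ρ w)

variable {W : WeierstrassCurve R⟦X⟧} {ρ : R⟦X⟧ →+* K} {V : Affine K}

theorem isFormalPair_zero : IsFormalPair W ρ V 0 0 :=
  ⟨0, 0, by simp, by simp, by simp [FormalEquation], by simp, by simp⟩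

variable [DecidableEq K] [V.IsElliptic]

theorem IsFormalPair.neg_add (hV : W.map ρ = V) (h₁ : d⁄dX R W.a₁ = 0) (h₂ : d⁄dX R W.a₂ = 0)
    (h₃ : d⁄dX R W.a₃ = 0) (h₄ : d⁄dX R W.a₄ = 0) (h₆ : V.a₆ = 0) {c₁ c₂ : R⟦X⟧}
    {P₁ P₂ : V.Point} (hP₁ : IsFormalPair W ρ V c₁ P₁) (hP₂ : IsFormalPair W ρ V c₂ P₂) :
    IsFormalPair W ρ V (-(c₁ + c₂)) (-(P₁ + P₂)) := by
  obtain ⟨u₁, w₁, hu₁, hw₁, e₁, d₁, rfl⟩ := hP₁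
  obtain ⟨u₂, w₂, hu₂, hw₂, e₂, d₂, rfl⟩ := hP₂
  obtain ⟨l, n, u₃, w₃, hl, hM, hu₃, hw₃⟩ := exists_isLineTriple e₁ e₂ hu₁ hw₁ hu₂ hw₂
  refine ⟨u₃, w₃, hu₃, hw₃, hl.formalEquation₃, ?_, ?_⟩
  · obtain ⟨c₃, hc₃⟩ := (isUnit_formalDen (W := W) hu₃ hw₃).dvd (a := d⁄dX R u₃)
    have := hl.sum_omega_eq_zero (d⁄dX R) h₁ h₂ h₃ h₄ hM
      (isUnit_formalDen hu₁ hw₁) (isUnit_formalDen hu₂ hw₂) (isUnit_formalDen hu₃ hw₃)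
      d₁ d₂ hc₃.symm
    rw [hc₃]
    linear_combination (-W.formalDen u₃ w₃) * this
  · subst hV
    have hne : ∀ {a : R⟦X⟧}, IsUnit a → ρ a ≠ 0 := fun h => (h.map ρ).ne_zero
    refine neg_eq_of_add_eq_zero_right ?_
    refine (hl.map ρ).formalPoint_sum h₆ ?_ ?_ ?_ ?_
    · rw [map_formalUnit]
      exact hne (isUnit_formalUnit hu₁ hw₁)
    · rw [map_formalUnit]
      exact hne (isUnit_formalUnit hu₂ hw₂)
    · rw [map_formalUnit]
      exact hne (isUnit_formalUnit hu₃ hw₃)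
    · simpa using hne hM

/-- The pairs of a value of the invariant differential and a point, as a group. -/
def formalSubgroup (hV : W.map ρ = V) (h₁ : d⁄dX R W.a₁ = 0) (h₂ : d⁄dX R W.a₂ = 0)
    (h₃ : d⁄dX R W.a₃ = 0) (h₄ : d⁄dX R W.a₄ = 0) (h₆ : V.a₆ = 0) :
    AddSubgroup (R⟦X⟧ × V.Point) :=
  have hneg : ∀ {c : R⟦X⟧} {P : V.Point}, IsFormalPair W ρ V c P → IsFormalPair W ρ V (-c) (-P) :=
    fun h => by simpa using h.neg_add hV h₁ h₂ h₃ h₄ h₆ isFormalPair_zero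
  { carrier := {x | IsFormalPair W ρ V x.1 x.2}
    zero_mem' := isFormalPair_zero
    add_mem' := fun ha hb => by simpa using hneg (ha.neg_add hV h₁ h₂ h₃ h₄ h₆ hb)
    neg_mem' := fun ha => hneg ha }

theorem IsFormalPair.zsmul_sub_zsmul_add (hV : W.map ρ = V) (h₁ : d⁄dX R W.a₁ = 0)
    (h₂ : d⁄dX R W.a₂ = 0) (h₃ : d⁄dX R W.a₃ = 0) (h₄ : d⁄dX R W.a₄ = 0) (h₆ : V.a₆ = 0)
    {c₁ c₂ c₃ : R⟦X⟧} {P₁ P₂ P₃ : V.Point} (hP₁ : IsFormalPair W ρ V c₁ P₁)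
    (hP₂ : IsFormalPair W ρ V c₂ P₂) (hP₃ : IsFormalPair W ρ V c₃ P₃) (m n : ℤ) :
    IsFormalPair W ρ V (m • c₁ - n • c₂ + c₃) (m • P₁ - n • P₂ + P₃) := by
  have := (formalSubgroup hV h₁ h₂ h₃ h₄ h₆).add_mem
    (AddSubgroup.sub_mem _ (AddSubgroup.zsmul_mem _ (x := (c₁, P₁)) hP₁ m)
      (AddSubgroup.zsmul_mem _ (x := (c₂, P₂)) hP₂ n)) (y := (c₃, P₃)) hP₃
  exact this

end FormalSubgroup

section Reduction

theorem FormalEquation.eq_of_eq {R : Type*} [CommRing R] {W : WeierstrassCurve R⟦X⟧}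
    {u w w' : R⟦X⟧} (h : W.FormalEquation u w) (h' : W.FormalEquation u w')
    (hu : constantCoeff u = 0) (hw : constantCoeff w = 0) (hw' : constantCoeff w' = 0) :
    w = w' := by
  have hU : IsUnit (1 - W.a₁ * u - W.a₂ * u ^ 2 - (W.a₃ + W.a₄ * u) * (w + w')) :=
    isUnit_of_constantCoeff_eq_one (by simp [hu, hw, hw'])
  rw [FormalEquation] at h h'
  rw [← sub_eq_zero, ← hU.mul_right_eq_zero]
  linear_combination h - h'

variable {k : Type*} [Field k]

theorem transcendental_powerSeries {f : k⟦X⟧} (hf : f ≠ 0) (h : constantCoeff f = 0) :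
    Transcendental k f := by
  intro ha
  obtain ⟨r, hr, hd⟩ := ha.exists_nonzero_dvd (mem_nonZeroDivisors_of_ne_zero hf)
  have := map_dvd (constantCoeff (R := k)) hd
  rw [h, zero_dvd_iff] at this
  exact hr (by simpa [PowerSeries.algebraMap_apply] using this)

variable {V : Affine k} {K : Type*} [Field K] [Algebra k K] [Algebra k⟦X⟧ K]
  [IsScalarTower k k⟦X⟧ K]

open scoped WeierstrassCurve.Affine

variable (V K) in
theorem map_C_map_algebraMap :
    (V.map (PowerSeries.C : k →+* k⟦X⟧)).map (algebraMap k⟦X⟧ K) = V⁄K := by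
  refine (WeierstrassCurve.map_map V _ _).trans ?_
  rw [Affine.baseChange, WeierstrassCurve.baseChange, IsScalarTower.algebraMap_eq k k⟦X⟧ K]
  rfl

theorem FormalEquation.map_algebraMap {u w : k⟦X⟧}
    (h : FormalEquation (V.map (PowerSeries.C : k →+* k⟦X⟧)) u w) :
    FormalEquation (V⁄K) (algebraMap k⟦X⟧ K u) (algebraMap k⟦X⟧ K w) := by
  rw [← map_C_map_algebraMap]
  exact h.map _

instance [V.IsElliptic] : WeierstrassCurve.IsElliptic (V⁄K) :=
  inferInstanceAs ((WeierstrassCurve.map V (algebraMap k K)).IsElliptic)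

variable [FaithfulSMul k⟦X⟧ K]

theorem FormalEquation.transcendental {u w : k⟦X⟧}
    (h : FormalEquation (V.map (PowerSeries.C : k →+* k⟦X⟧)) u w) (hu : u ≠ 0)
    (hu₀ : constantCoeff u = 0) (hw₀ : constantCoeff w = 0) :
    Transcendental k (algebraMap k⟦X⟧ K u / algebraMap k⟦X⟧ K w) := by
  have inj := FaithfulSMul.algebraMap_injective k⟦X⟧ K
  have hE := h.mul_formalUnit
  obtain ⟨d, hd⟩ := (isUnit_formalUnit (W := V.map PowerSeries.C) hu₀ hw₀).exists_right_inv
  have hw : w = u * (u ^ 2 * d) := by linear_combination (-w) * hd + d * hE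
  have hd₀ : d ≠ 0 := by rintro rfl; simp at hd
  have key : Transcendental k (u ^ 2 * d) :=
    transcendental_powerSeries (mul_ne_zero (pow_ne_zero 2 hu) hd₀) (by simp [hu₀])
  rw [hw, map_mul, ← div_div, div_self (by simpa using inj.ne hu), one_div]
  intro ha
  rw [IsAlgebraic.inv_iff] at ha
  exact key ((isAlgebraic_algebraMap_iff inj).mp ha)

variable [V.IsElliptic]

theorem FormalEquation.eq_zero_of_two_smul [DecidableEq K] (h₆ : V.a₆ = 0) {u w : k⟦X⟧}
    (h : FormalEquation (V.map (PowerSeries.C : k →+* k⟦X⟧)) u w)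
    (hu₀ : constantCoeff u = 0) (hw₀ : constantCoeff w = 0)
    (h2 : (2 : ℤ) • formalPoint (V⁄K) (algebraMap k⟦X⟧ K u) (algebraMap k⟦X⟧ K w) = 0) :
    u = 0 := by
  have inj := FaithfulSMul.algebraMap_injective k⟦X⟧ K
  have hE := h.mul_formalUnit
  by_contra hu
  have hw : w ≠ 0 := by
    rintro rfl
    rw [zero_mul, eq_comm, pow_eq_zero_iff three_ne_zero] at hE
    exact hu hE
  have hw' : algebraMap k⟦X⟧ K w ≠ 0 := by simpa using inj.ne hw
  have hK := h.map_algebraMap (K := K)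
  have h₆' : (V⁄K).a₆ = 0 := by simp [h₆]
  rw [hK.formalPoint_of_ne h₆' hw', two_zsmul, ← eq_neg_iff_add_eq_zero, Affine.Point.neg_some,
    Affine.Point.some.injEq, Affine.negY] at h2
  have hY := h2.2
  have hc : ∀ a : k, algebraMap k K a = algebraMap k⟦X⟧ K (PowerSeries.C a) := fun a =>
    IsScalarTower.algebraMap_apply k k⟦X⟧ K a
  rw [show (V⁄K).a₁ = _ from hc V.a₁, show (V⁄K).a₃ = _ from hc V.a₃] at hY
  field_simp at hY
  have h2' : (2 : k⟦X⟧) = PowerSeries.C V.a₁ * u + PowerSeries.C V.a₃ * w := by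
    apply inj
    simp only [map_ofNat, map_add, map_mul]
    linear_combination -hY
  have two : (2 : k) = 0 := by
    have := congrArg (constantCoeff (R := k)) h2'
    simpa [hu₀, hw₀, map_ofNat constantCoeff 2] using this
  have two' : (2 : k⟦X⟧) = 0 := by
    have := congrArg (PowerSeries.C (R := k)) two
    simpa [map_ofNat (PowerSeries.C (R := k)) 2] using this
  have h₁₃ : PowerSeries.C V.a₁ * formalUnit (V.map PowerSeries.C) u w +
      PowerSeries.C V.a₃ * u ^ 2 = 0 := by
    apply mul_left_cancel₀ hu
    linear_combination (-formalUnit (V.map PowerSeries.C) u w) * h2' - PowerSeries.C V.a₃ * hE +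
      formalUnit (V.map PowerSeries.C) u w * two'
  have a₁ : V.a₁ = 0 := by
    have := congrArg (constantCoeff (R := k)) h₁₃
    simpa [formalUnit, hu₀, hw₀] using this
  have a₃ : V.a₃ = 0 := by
    rw [a₁] at h₁₃
    simpa [hu] using h₁₃
  refine V.isUnit_Δ.ne_zero ?_
  rw [Δ, b₂, b₄, b₆, b₈, a₁, a₃, h₆]
  linear_combination (-32 * V.a₄ ^ 3 + 8 * V.a₂ ^ 2 * V.a₄ ^ 2) * two

theorem FormalEquation.eq_zero_of_hasHeight [DecidableEq K] (h₆ : V.a₆ = 0) {u w : k⟦X⟧}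
    (h : FormalEquation (V.map (PowerSeries.C : k →+* k⟦X⟧)) u w)
    (hu₀ : constantCoeff u = 0) (hw₀ : constantCoeff w = 0) {x : K}
    (hx : HasHeight x
      ((2 : ℤ) • formalPoint (V⁄K) (algebraMap k⟦X⟧ K u) (algebraMap k⟦X⟧ K w)) 0) :
    u = 0 := by
  have inj := FaithfulSMul.algebraMap_injective k⟦X⟧ K
  refine h.eq_zero_of_two_smul h₆ hu₀ hw₀ (K := K) ?_
  have h₆' : (V⁄K).a₆ = 0 := by simp [h₆]
  obtain ⟨c, hc⟩ := (isUnit_formalDen (W := V.map PowerSeries.C) hu₀ hw₀).dvd (a := d⁄dX k u)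
  have hp : IsFormalPair (V.map PowerSeries.C) (algebraMap k⟦X⟧ K) (V⁄K) c
      (formalPoint (V⁄K) (algebraMap k⟦X⟧ K u) (algebraMap k⟦X⟧ K w)) :=
    ⟨u, w, hu₀, hw₀, h, hc.symm, rfl⟩
  obtain ⟨u', w', hu', hw', h', -, hP⟩ := hp.zsmul_sub_zsmul_add (map_C_map_algebraMap V K)
    (by simp) (by simp) (by simp) (by simp) h₆' hp hp 1 0
  rw [one_smul, zero_smul, sub_zero, ← two_zsmul] at hP
  rw [hP] at hx ⊢
  refine hx.eq_zero_or_exists_algebraMap.resolve_right ?_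
  rintro ⟨r, y, hy, hr⟩
  by_cases hw0 : w' = 0
  · rw [hw0, map_zero, formalPoint_zero_right] at hr
    exact Affine.Point.some_ne_zero hy hr.symm
  have hw1 : algebraMap k⟦X⟧ K w' ≠ 0 := by simpa using inj.ne hw0
  have hK := h'.map_algebraMap (K := K)
  rw [hK.formalPoint_of_ne h₆' hw1, Affine.Point.some.injEq] at hr
  have hu1 : u' ≠ 0 := by
    rintro rfl
    have := h'.mul_formalUnit
    simp [hw0, (isUnit_formalUnit hu' hw').ne_zero] at this
  exact h'.transcendental (K := K) hu1 hu' hw' (hr.1 ▸ isAlgebraic_algebraMap r)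

end Reduction

section FrobeniusPoint

variable {k : Type*} [Field k] [Fintype k] {V : Affine k} {K : Type*} [Field K] [Algebra k K]
  [DecidableEq K] [Algebra k⟦X⟧ K] [IsScalarTower k k⟦X⟧ K] [V.IsElliptic]

open scoped WeierstrassCurve.Affine

theorem FormalEquation.frob_formalPoint (h₆ : V.a₆ = 0) {u w : k⟦X⟧}
    (h : FormalEquation (V.map (PowerSeries.C : k →+* k⟦X⟧)) u w)
    (h' : FormalEquation (V.map (PowerSeries.C : k →+* k⟦X⟧)) (u ^ Fintype.card k)
      (w ^ Fintype.card k)) :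
    frob V K (formalPoint (V⁄K) (algebraMap k⟦X⟧ K u) (algebraMap k⟦X⟧ K w)) =
      formalPoint (V⁄K) (algebraMap k⟦X⟧ K (u ^ Fintype.card k))
        (algebraMap k⟦X⟧ K (w ^ Fintype.card k)) := by
  have h₆' : (V⁄K).a₆ = 0 := by simp [h₆]
  by_cases hw : algebraMap k⟦X⟧ K w = 0
  · simp [hw, Fintype.card_ne_zero]
  have hw' : algebraMap k⟦X⟧ K (w ^ Fintype.card k) ≠ 0 := by
    rw [map_pow]
    exact pow_ne_zero _ hw
  have hf : ∀ z : K, FiniteField.frobeniusAlgHom k K z = z ^ Fintype.card k := fun z => by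
    rw [FiniteField.coe_frobeniusAlgHom]
  rw [(h.map_algebraMap (K := K)).formalPoint_of_ne h₆' hw,
    (h'.map_algebraMap (K := K)).formalPoint_of_ne h₆' hw', frob, Affine.Point.map_some,
    Affine.Point.some.injEq, map_div₀, map_div₀, map_neg, map_one, hf, hf, map_pow, map_pow]
  exact ⟨rfl, rfl⟩

end FrobeniusPoint

theorem expand_eq_pow {p : ℕ} [Fact p.Prime] (f : (ZMod p)⟦X⟧) (hp : p ≠ 0) :
    PowerSeries.expand p hp f = f ^ p := by
  have := MvPowerSeries.map_frobenius_expand (R := ZMod p) p hp (f := f)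
  rw [ZMod.frobenius_zmod, MvPowerSeries.map_id] at this
  exact this

section FormalPower

variable {R : Type*} [CommRing R] {W : WeierstrassCurve R} {w₀ g : R⟦X⟧}

theorem FormalEquation.expand (h : FormalEquation (W.map (PowerSeries.C : R →+* R⟦X⟧)) X w₀)
    {m : ℕ} (hm : m ≠ 0) :
    FormalEquation (W.map (PowerSeries.C : R →+* R⟦X⟧)) (X ^ m) (PowerSeries.expand m hm w₀) := by
  have := congrArg (PowerSeries.expand m hm) h
  simpa [FormalEquation, PowerSeries.expand_C] using this

theorem formalDen_expand {m : ℕ} (hm : m ≠ 0) :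
    formalDen (W.map (PowerSeries.C : R →+* R⟦X⟧)) (X ^ m) (PowerSeries.expand m hm w₀) =
      PowerSeries.expand m hm (formalDen (W.map (PowerSeries.C : R →+* R⟦X⟧)) X w₀) := by
  simp [formalDen, PowerSeries.expand_C, map_ofNat (PowerSeries.expand m hm) 2]

theorem isFormalPair_expand (h : FormalEquation (W.map (PowerSeries.C : R →+* R⟦X⟧)) X w₀)
    (hw₀ : constantCoeff w₀ = 0)
    (hg : formalDen (W.map (PowerSeries.C : R →+* R⟦X⟧)) X w₀ * g = 1) {m : ℕ} (hm : m ≠ 0)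
    {K : Type*} [Field K] (ρ : R⟦X⟧ →+* K) (V : Affine K) :
    IsFormalPair (W.map (PowerSeries.C : R →+* R⟦X⟧)) ρ V
      ((m : R⟦X⟧) * X ^ (m - 1) * PowerSeries.expand m hm g)
      (formalPoint V (ρ (X ^ m)) (ρ (PowerSeries.expand m hm w₀))) := by
  refine ⟨X ^ m, PowerSeries.expand m hm w₀, by simp [hm], ?_, h.expand hm, ?_, rfl⟩
  · rw [PowerSeries.constantCoeff_expand, hw₀]
  · have := congrArg (PowerSeries.expand m hm) hg
    rw [map_mul, map_one] at this
    rw [formalDen_expand, Derivation.leibniz_pow, derivative_X]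
    simp only [smul_eq_mul, nsmul_eq_mul, mul_one]
    linear_combination ((m : R⟦X⟧) * X ^ (m - 1)) * this

end FormalPower

open scoped WeierstrassCurve.Affine

theorem exists_frobenius_point {W : WeierstrassCurve ℤ} (h₆ : W.a₆ = 0) {w₀ g : ℤ⟦X⟧}
    (h : FormalEquation (W.map (PowerSeries.C : ℤ →+* ℤ⟦X⟧)) X w₀) (hw₀ : constantCoeff w₀ = 0)
    (hg : formalDen (W.map (PowerSeries.C : ℤ →+* ℤ⟦X⟧)) X w₀ * g = 1) (p : ℕ) [Fact p.Prime]
    [(W.map (Int.castRingHom (ZMod p))).IsElliptic] (hp : p ≠ 0) {t : ℤ}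
    (ht : t = p - Nat.card {P : ZMod p × ZMod p //
      Affine.Equation (W.map (Int.castRingHom (ZMod p))) P.1 P.2}) :
    ∃ v w : ℤ⟦X⟧, constantCoeff v = 0 ∧ constantCoeff w = 0 ∧
      FormalEquation (W.map (PowerSeries.C : ℤ →+* ℤ⟦X⟧)) (p * v) w ∧
      formalDen (W.map (PowerSeries.C : ℤ →+* ℤ⟦X⟧)) (p * v) w *
        ((p : ℤ⟦X⟧) * g - (t : ℤ⟦X⟧) * ((p : ℤ⟦X⟧) * X ^ (p - 1) * PowerSeries.expand p hp g) +
          ((p * p : ℕ) : ℤ⟦X⟧) * X ^ (p * p - 1) *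
            PowerSeries.expand (p * p) (mul_ne_zero hp hp) g) =
        (p : ℤ⟦X⟧) * d⁄dX ℤ v := by
  classical
  set k := ZMod p
  set V : Affine k := W.map (Int.castRingHom k) with hVdef
  let K := FractionRing k⟦X⟧
  have h₆V : V.a₆ = 0 := by simp [hVdef, h₆]
  let r : ℤ⟦X⟧ →+* k⟦X⟧ := PowerSeries.map (Int.castRingHom k)
  let ρ : ℤ⟦X⟧ →+* K := (algebraMap k⟦X⟧ K).comp r
  have hr : (W.map (PowerSeries.C : ℤ →+* ℤ⟦X⟧)).map r = V.map (PowerSeries.C : k →+* k⟦X⟧) := by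
    refine (WeierstrassCurve.map_map W _ _).trans
      (Eq.trans ?_ (WeierstrassCurve.map_map W _ _).symm)
    rw [RingHom.ext_int (r.comp PowerSeries.C) _]
  have hρ : (W.map (PowerSeries.C : ℤ →+* ℤ⟦X⟧)).map ρ = V⁄K := by
    rw [← map_C_map_algebraMap V K, ← hr]
    exact (WeierstrassCurve.map_map _ _ _).symm
  have mapEq : ∀ {u w : ℤ⟦X⟧}, FormalEquation (W.map (PowerSeries.C : ℤ →+* ℤ⟦X⟧)) u w →
      FormalEquation (V.map (PowerSeries.C : k →+* k⟦X⟧)) (r u) (r w) := fun h => hr ▸ h.map r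
  have hpow : ∀ f : ℤ⟦X⟧, r (PowerSeries.expand p hp f) = r f ^ Fintype.card k := by
    intro f
    rw [ZMod.card, ← expand_eq_pow _ hp, ← PowerSeries.map_expand]
  have frob_eq : ∀ {u w : ℤ⟦X⟧}, FormalEquation (W.map (PowerSeries.C : ℤ →+* ℤ⟦X⟧)) u w →
      FormalEquation (W.map (PowerSeries.C : ℤ →+* ℤ⟦X⟧)) (PowerSeries.expand p hp u)
        (PowerSeries.expand p hp w) →
      frob V K (formalPoint (V⁄K) (ρ u) (ρ w)) =
        formalPoint (V⁄K) (ρ (PowerSeries.expand p hp u)) (ρ (PowerSeries.expand p hp w)) := by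
    intro u w h h'
    have h₁ := mapEq h'
    rw [hpow, hpow] at h₁
    simp only [ρ, RingHom.comp_apply, hpow]
    exact (mapEq h).frob_formalPoint h₆V h₁
  have hX : PowerSeries.expand p hp (X : ℤ⟦X⟧) = X ^ p := PowerSeries.expand_X ..
  have hXp : PowerSeries.expand p hp (X ^ p : ℤ⟦X⟧) = X ^ (p * p) := by
    rw [map_pow, hX, pow_mul]
  have f₁ := frob_eq h (hX.symm ▸ h.expand hp)
  rw [hX] at f₁
  have hpp := h.expand (mul_ne_zero hp hp)
  have f₂ := frob_eq (h.expand hp) (by rwa [hXp, ← PowerSeries.expand_mul])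
  rw [hXp, ← PowerSeries.expand_mul] at f₂
  have p₁ : IsFormalPair (W.map (PowerSeries.C : ℤ →+* ℤ⟦X⟧)) ρ (V⁄K) g
      (formalPoint (V⁄K) (ρ X) (ρ w₀)) :=
    ⟨X, w₀, by simp, hw₀, h, by rw [hg, derivative_X], rfl⟩
  obtain ⟨u, w, hu, hw, hE, hc, hP⟩ := p₁.zsmul_sub_zsmul_add hρ (by simp) (by simp) (by simp)
    (by simp) (by simp [h₆V]) (isFormalPair_expand h hw₀ hg hp ρ (V⁄K))
    (isFormalPair_expand h hw₀ hg (mul_ne_zero hp hp) ρ (V⁄K)) p t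
  rw [← f₂, ← f₁] at hP
  have hrc : ∀ f : ℤ⟦X⟧, constantCoeff f = 0 → constantCoeff (r f) = 0 := by
    intro f hf
    simp only [r]
    rw [← coeff_zero_eq_constantCoeff_apply, coeff_map, coeff_zero_eq_constantCoeff_apply, hf,
      map_zero]
  have hXne : r X ≠ 0 := by
    simp only [r, PowerSeries.map_X]
    exact X_ne_zero
  have hxt := (mapEq h).transcendental (K := K) hXne (hrc _ (by simp)) (hrc _ hw₀)
  have hw₀' : ρ w₀ ≠ 0 := by
    intro h0
    change algebraMap k⟦X⟧ K (r w₀) = 0 at h0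
    rw [h0, div_zero] at hxt
    exact hxt isAlgebraic_zero
  have hQ := (mapEq h).map_algebraMap (K := K)
  have hht := hasHeight_frob_char hxt (W := V)
    ((V⁄K).equation_iff_nonsingular.mp (hQ.equation (by simp [h₆V]) hw₀'))
    (ht.trans (by rw [ZMod.card]))
  rw [← hQ.formalPoint_of_ne (by simp [h₆V]) hw₀', ZMod.card] at hht
  have hu0 : r u = 0 := by
    refine (mapEq hE).eq_zero_of_hasHeight h₆V (hrc _ hu) (hrc _ hw)
      (x := algebraMap k⟦X⟧ K (r X) / algebraMap k⟦X⟧ K (r w₀)) ?_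
    exact hP ▸ hht
  have hdvd : ∀ n, (p : ℤ) ∣ coeff n u := by
    intro n
    have := congrArg (coeff n) hu0
    rw [coeff_map, map_zero, eq_intCast] at this
    exact (ZMod.intCast_zmod_eq_zero_iff_dvd _ _).mp this
  choose a ha using hdvd
  have hpv : u = p * PowerSeries.mk a := by
    ext n
    rw [← map_natCast (PowerSeries.C (R := ℤ)), coeff_C_mul, coeff_mk, ha]
  subst hpv
  refine ⟨PowerSeries.mk a, w, ?_, hw, hE, ?_⟩
  · simpa [hp] using hu
  · simpa [zsmul_eq_mul, Derivation.leibniz] using hc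

end WeierstrassCurve

namespace PowerSeries

theorem coeff_ringHom_mul (φ : ℤ⟦X⟧ →+* ℤ⟦X⟧) {u : ℤ⟦X⟧} (hφ : φ X = u)
    (hu : constantCoeff u = 0) (f h : ℤ⟦X⟧) (n : ℕ) :
    coeff n (φ f * h) = ∑ i ∈ range (n + 1), coeff i f * coeff n (u ^ i * h) := by
  have hC : ∀ a : ℤ, φ (C a) = C a :=
    RingHom.congr_fun (RingHom.ext_int (φ.comp C) C)
  obtain ⟨r, hr⟩ : (X : ℤ⟦X⟧) ^ (n + 1) ∣ f - ∑ i ∈ range (n + 1), C (coeff i f) * X ^ i := by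
    rw [X_pow_dvd_iff]
    intro j hj
    rw [map_sub, map_sum, sum_eq_single j]
    · rw [coeff_C_mul, coeff_X_pow_self, mul_one, sub_self]
    · intro i _ hij
      rw [coeff_C_mul, coeff_X_pow, if_neg hij.symm, mul_zero]
    · exact fun h => absurd (mem_range.mpr hj) h
  rw [sub_eq_iff_eq_add] at hr
  have h₀ : coeff n (u ^ (n + 1) * (φ r * h)) = 0 :=
    X_pow_dvd_iff.mp ((pow_dvd_pow_of_dvd (X_dvd_iff.mpr hu) _).mul_right _) n (Nat.lt_succ_self n)
  have h₁ := congrArg φ hr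
  rw [map_add, map_mul, map_pow, hφ, map_sum] at h₁
  rw [h₁, add_mul, map_add, mul_assoc, h₀, zero_add, sum_mul, map_sum]
  refine sum_congr rfl fun i _ => ?_
  rw [map_mul φ, map_pow, hφ, hC, mul_assoc, coeff_C_mul]

theorem exists_ringHom_X_eq {u : ℤ⟦X⟧} (hu : constantCoeff u = 0) :
    ∃ φ : ℤ⟦X⟧ →+* ℤ⟦X⟧, φ X = u :=
  ⟨(substAlgHom (R := ℤ) (HasSubst.of_constantCoeff_zero' hu)).toRingHom, substAlgHom_X _⟩

end PowerSeries

theorem pow_dvd_pow_mul_of_dvd_succ_mul {p : ℕ} (hp : p.Prime) {s i : ℕ} {y : ℤ}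
    (h : (p : ℤ) ^ s ∣ (i + 1 : ℕ) * y) : (p : ℤ) ^ s ∣ (p : ℤ) ^ i * y := by
  obtain ⟨e, q, hq, hi⟩ := Nat.exists_eq_pow_mul_and_not_dvd i.succ_ne_zero p hp.ne_one
  have he : e ≤ i := by
    have h₁ : e < p ^ e := Nat.lt_pow_self hp.one_lt
    have h₂ : p ^ e ≤ i + 1 := by
      rw [Nat.succ_eq_add_one] at hi
      exact hi ▸ Nat.le_mul_of_pos_right _ (Nat.pos_of_ne_zero (by rintro rfl; simp at hq))
    omega
  rcases le_total s e with hs | hs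
  · exact ((pow_dvd_pow _ (hs.trans he))).mul_right _
  · obtain ⟨d, rfl⟩ := Nat.exists_eq_add_of_le hs
    rw [Nat.succ_eq_add_one] at hi
    rw [hi, Nat.cast_mul, Nat.cast_pow, mul_assoc, pow_add,
      mul_dvd_mul_iff_left (pow_ne_zero _ (Nat.cast_ne_zero.mpr hp.ne_zero))] at h
    have hc : IsCoprime ((p : ℤ) ^ d) q :=
      (Nat.isCoprime_iff_coprime.mpr ((Nat.Prime.coprime_iff_not_dvd hp).mpr hq)).pow_left
    rw [pow_add]
    exact mul_dvd_mul (pow_dvd_pow _ he) (hc.dvd_of_dvd_mul_left h)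

theorem dvd_coeff_subst_mul_derivative {p : ℕ} (hp : p.Prime) {v : ℤ⟦X⟧}
    (hv : constantCoeff v = 0) (φ : ℤ⟦X⟧ →+* ℤ⟦X⟧) (hφ : φ X = p * v) (g : ℤ⟦X⟧) {s m : ℕ}
    (hm : p ^ s ∣ m + 1) : (p : ℤ) ^ (s + 1) ∣ coeff m (φ g * (p * d⁄dX ℤ v)) := by
  rw [coeff_ringHom_mul φ hφ (by simp [hv])]
  refine dvd_sum fun i _ => Dvd.dvd.mul_left ?_ _
  have e : ((p : ℤ⟦X⟧) * v) ^ i * (p * d⁄dX ℤ v) =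
      PowerSeries.C ((p : ℤ) * p ^ i) * (v ^ i * d⁄dX ℤ v) := by
    simp only [map_mul, map_pow, map_natCast]
    ring
  have e' : (((i + 1 : ℕ) : ℤ)) * coeff m (v ^ i * d⁄dX ℤ v) =
      (m + 1 : ℕ) * coeff (m + 1) (v ^ (i + 1)) := by
    have h₁ := coeff_derivative (v ^ (i + 1)) m
    rw [Derivation.leibniz_pow, Nat.add_sub_cancel, smul_eq_mul, map_nsmul, nsmul_eq_mul] at h₁
    rw [h₁]
    push_cast
    ring
  rw [e, coeff_C_mul, pow_succ', mul_assoc]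
  refine mul_dvd_mul_left _ (pow_dvd_pow_mul_of_dvd_succ_mul hp ?_)
  rw [e']
  exact Dvd.dvd.mul_right (by exact_mod_cast hm) _

theorem coeff_X_pow_mul_expand {R : Type*} [CommRing R] (g : R⟦X⟧) {m n : ℕ} (hm : m ≠ 0)
    (hn : n ≠ 0) : coeff (n - 1) (X ^ (m - 1) * PowerSeries.expand m hm g) =
      if m ∣ n then coeff (n / m - 1) g else 0 := by
  rw [coeff_X_pow_mul']
  split_ifs with h₁ h₂ h₂
  · obtain ⟨q, rfl⟩ := h₂
    obtain ⟨q, rfl⟩ := Nat.exists_eq_succ_of_ne_zero (right_ne_zero_of_mul hn)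
    have : m * q.succ - 1 - (m - 1) = m * q := by
      rw [Nat.mul_succ]
      omega
    rw [this, coeff_expand_mul, Nat.mul_div_cancel_left _ (Nat.pos_of_ne_zero hm)]
    rfl
  · refine coeff_expand_of_not_dvd _ _ _ fun hd => h₂ ?_
    have : n = m + (n - 1 - (m - 1)) := by omega
    rw [this]
    exact (Nat.dvd_add_right dvd_rfl).mpr hd
  · have := Nat.le_of_dvd (Nat.pos_of_ne_zero hn) h₂
    omega
  · rfl

namespace WeierstrassCurve

theorem map_formalDen {A B : Type*} [CommRing A] [CommRing B] {W : WeierstrassCurve A}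
    (f : A →+* B) (u w : A) : (W.map f).formalDen (f u) (f w) = f (W.formalDen u w) := by
  simp [formalDen, map_ofNat f 2]

theorem coeff_congruence {W : WeierstrassCurve ℤ} (h₆ : W.a₆ = 0) {w₀ g : ℤ⟦X⟧}
    (h : FormalEquation (W.map (PowerSeries.C : ℤ →+* ℤ⟦X⟧)) X w₀) (hw₀ : constantCoeff w₀ = 0)
    (hg : formalDen (W.map (PowerSeries.C : ℤ →+* ℤ⟦X⟧)) X w₀ * g = 1) {p : ℕ} (hp : p.Prime)
    [Fact p.Prime] [(W.map (Int.castRingHom (ZMod p))).IsElliptic] {t : ℤ}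
    (ht : t = p - Nat.card {P : ZMod p × ZMod p //
      Affine.Equation (W.map (Int.castRingHom (ZMod p))) P.1 P.2}) {s n : ℕ} (hn : n ≠ 0)
    (hs : p ^ s ∣ n * p) :
    (p : ℤ) ^ s ∣ coeff (n * p - 1) g - t * coeff (n - 1) g +
      p * if p ∣ n then coeff (n / p - 1) g else 0 := by
  have hp₀ := hp.ne_zero
  obtain ⟨v, w, hv, hw, hE, hc⟩ := exists_frobenius_point h₆ h hw₀ hg p hp₀ ht
  have hpv : constantCoeff ((p : ℤ⟦X⟧) * v) = 0 := by simp [hv]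
  obtain ⟨φ, hφ⟩ := exists_ringHom_X_eq hpv
  have hW : (W.map (PowerSeries.C : ℤ →+* ℤ⟦X⟧)).map φ = W.map PowerSeries.C := by
    rw [WeierstrassCurve.map_map]
    exact congrArg W.map (RingHom.ext_int _ _)
  have hEφ := h.map φ
  rw [hW, hφ] at hEφ
  have hφw₀ : constantCoeff (φ w₀) = 0 := by
    obtain ⟨f, rfl⟩ := X_dvd_iff.mpr hw₀
    rw [map_mul, hφ, map_mul, hpv, zero_mul]
  obtain rfl := hE.eq_of_eq hEφ hpv hw hφw₀
  have hgφ := congrArg φ hg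
  rw [map_mul, map_one, ← map_formalDen, hW, hφ] at hgφ
  have key := dvd_coeff_subst_mul_derivative hp hv φ hφ g (s := s) (m := n * p - 1)
    (by rwa [Nat.sub_add_cancel (Nat.mul_pos (Nat.pos_of_ne_zero hn) hp.pos)])
  rw [← hc, ← mul_assoc, mul_comm (φ g), hgφ, one_mul] at key
  have hnp : n * p ≠ 0 := mul_ne_zero hn hp₀
  have e₁ := coeff_X_pow_mul_expand g hp₀ hnp
  have e₂ := coeff_X_pow_mul_expand g (mul_ne_zero hp₀ hp₀) hnp
  rw [if_pos (dvd_mul_left p n), Nat.mul_div_cancel _ hp.pos] at e₁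
  rw [Nat.mul_div_mul_right _ _ hp.pos] at e₂
  simp only [Nat.mul_dvd_mul_iff_right hp.pos] at e₂
  have e : (p : ℤ⟦X⟧) * g - (t : ℤ⟦X⟧) * ((p : ℤ⟦X⟧) * X ^ (p - 1) * PowerSeries.expand p hp₀ g) +
      ((p * p : ℕ) : ℤ⟦X⟧) * X ^ (p * p - 1) * PowerSeries.expand (p * p) (mul_ne_zero hp₀ hp₀) g =
      PowerSeries.C (p : ℤ) * (g - PowerSeries.C t * (X ^ (p - 1) * PowerSeries.expand p hp₀ g) +
        PowerSeries.C (p : ℤ) *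
          (X ^ (p * p - 1) * PowerSeries.expand (p * p) (mul_ne_zero hp₀ hp₀) g)) := by
    rw [show (t : ℤ⟦X⟧) = PowerSeries.C t from (map_intCast (PowerSeries.C (R := ℤ)) t).symm]
    push_cast [map_natCast]
    ring
  rw [e, coeff_C_mul, map_add, map_sub, coeff_C_mul, coeff_C_mul, e₁, e₂, pow_succ',
    mul_dvd_mul_iff_left (Nat.cast_ne_zero.mpr hp₀)] at key
  exact key

end WeierstrassCurve

namespace PowerSeries

theorem catalan_series_eq (R : Type*) [CommRing R] :
    (mk fun n => (catalan n : R)) = 1 + X * (mk fun n => (catalan n : R)) ^ 2 := by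
  have h := congrArg (map (Nat.castRingHom R)) catalanSeries_sq_mul_X_add_one
  have e : map (Nat.castRingHom R) catalanSeries = mk fun n => (catalan n : R) := by
    ext n
    simp
  simp only [map_add, map_mul, map_pow, map_one, map_X, e] at h
  linear_combination -h

theorem centralBinom_series_mul (R : Type*) [CommRing R] :
    (mk fun n => (n.centralBinom : R)) * (1 - 2 * X * mk fun n => (catalan n : R)) = 1 := by
  have h : (mk fun n => (n.centralBinom : R)) = d⁄dX R (X * mk fun n => (catalan n : R)) := by
    ext n
    rw [coeff_derivative, coeff_succ_X_mul, coeff_mk, coeff_mk, ← succ_mul_catalan_eq_centralBinom]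
    push_cast
    ring
  have h' := congrArg (fun f => d⁄dX R (X * f)) (catalan_series_eq R)
  have e : (X : R⟦X⟧) * (1 + X * (mk fun n => (catalan n : R)) ^ 2) =
      X + (X * mk fun n => (catalan n : R)) ^ 2 := by ring
  simp only [e] at h'
  rw [map_add, Derivation.leibniz_pow, derivative_X, ← h, nsmul_eq_mul, pow_one, smul_eq_mul] at h'
  push_cast at h'
  linear_combination h'

theorem coeff_C_mul_X_add_C_pow {R : Type*} [CommRing R] (a b : R) (j r : ℕ) :
    coeff r ((C b * X + C a) ^ j) = j.choose r * a ^ (j - r) * b ^ r := by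
  rw [add_pow, map_sum]
  have : ∀ i, coeff r ((C b * X) ^ i * C a ^ (j - i) * (j.choose i : R⟦X⟧)) =
      if r = i then j.choose r * a ^ (j - r) * b ^ r else 0 := by
    intro i
    have e : (C b * X) ^ i * C a ^ (j - i) * (j.choose i : R⟦X⟧) =
        C (j.choose i * a ^ (j - i) * b ^ i) * X ^ i := by
      rw [map_mul, map_mul, map_natCast, map_pow, map_pow]
      ring
    rw [e, coeff_C_mul, coeff_X_pow]
    split_ifs with h
    · rw [h, mul_one]
    · rw [mul_zero]
  simp only [this]
  rw [sum_ite_eq]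
  split_ifs with h
  · rfl
  · rw [Nat.choose_eq_zero_of_lt (by simpa using h)]
    simp

end PowerSeries

theorem coeff_pow_mul_pow (a₁ a₂ a₃ a₄ : ℤ) (j k n : ℕ) :
    coeff n ((PowerSeries.C a₁ * X + PowerSeries.C a₂ * X ^ 2 : ℤ⟦X⟧) ^ j *
      (X ^ 3 * (PowerSeries.C a₃ + PowerSeries.C a₄ * X)) ^ k) =
    ∑ r ∈ range (n + 1 - (2 * k + j) - k), (j.choose r * k.choose (n - (2 * k + j) - k - r) : ℤ) *
      a₁ ^ (j - r) * a₂ ^ r * a₃ ^ (2 * k + (2 * k + j) + r - n) *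
        a₄ ^ (n - (2 * k + j) - k - r) := by
  have e : (PowerSeries.C a₁ * X + PowerSeries.C a₂ * X ^ 2 : ℤ⟦X⟧) ^ j *
      (X ^ 3 * (PowerSeries.C a₃ + PowerSeries.C a₄ * X)) ^ k =
      X ^ (3 * k + j) * ((PowerSeries.C a₂ * X + PowerSeries.C a₁) ^ j *
        (PowerSeries.C a₄ * X + PowerSeries.C a₃) ^ k) := by
    rw [show (PowerSeries.C a₁ * X + PowerSeries.C a₂ * X ^ 2 : ℤ⟦X⟧) =
      X * (PowerSeries.C a₂ * X + PowerSeries.C a₁) by ring, mul_pow, mul_pow, pow_add, pow_mul,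
      add_comm (PowerSeries.C a₃)]
    ring
  rw [e, coeff_X_pow_mul']
  split_ifs with h
  · have hq : n + 1 - (2 * k + j) - k = n - (3 * k + j) + 1 := by omega
    rw [hq, coeff_mul, Nat.sum_antidiagonal_eq_sum_range_succ_mk]
    refine sum_congr rfl fun r hr => ?_
    rw [mem_range] at hr
    simp only [coeff_C_mul_X_add_C_pow]
    have h₁ : n - (2 * k + j) - k - r = n - (3 * k + j) - r := by omega
    rw [h₁]
    by_cases hk : n - (3 * k + j) - r ≤ k
    · have h₂ : 2 * k + (2 * k + j) + r - n = k - (n - (3 * k + j) - r) := by omega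
      rw [h₂]
      ring
    · rw [Nat.choose_eq_zero_of_lt (not_le.mp hk)]
      simp
  · rw [show n + 1 - (2 * k + j) - k = 0 by omega, sum_range_zero]

theorem choose_mul_choose_eq_centralBinom_mul (k j : ℕ) :
    (2 * k + j).choose k * (2 * k + j - k).choose k =
      k.centralBinom * (2 * k + j).choose (2 * k) := by
  have h := Nat.choose_mul (n := 2 * k + j) (k := 2 * k) (s := k) (by omega)
  rw [show 2 * k - k = k by omega] at h
  rw [← h, Nat.centralBinom_eq_two_mul_choose, mul_comm]

theorem sum_range_ite_le_eq {M : Type*} [AddCommMonoid M] (n a : ℕ) (f : ℕ → M)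
    (hf : ∀ m, n < m → f m = 0) :
    (∑ m ∈ range (n + 1), if a ≤ m then f m else 0) = ∑ j ∈ range (n + 1), f (a + j) := by
  have h : (∑ m ∈ range (n + 1), if a ≤ m then f m else 0) =
      ∑ m ∈ range (a + (n + 1)), if a ≤ m then f m else 0 := by
    refine sum_subset (range_mono (by omega)) fun m _ hm => ?_
    rw [hf m (by simpa using hm), ite_self]
  rw [h, sum_range_add, sum_eq_zero fun m hm => if_neg (by simpa using hm), zero_add]
  exact sum_congr rfl fun j _ => if_pos (by omega)

theorem bCoeff_eq_sum (a₁ a₂ a₃ a₄ : ℤ) (n : ℕ) :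
    bCoeff a₁ a₂ a₃ a₄ n = ∑ k ∈ range (n + 1), (k.centralBinom : ℤ) *
      ∑ j ∈ range (n + 1), ((2 * k + j).choose (2 * k) : ℤ) *
        ∑ r ∈ range (n + 1 - (2 * k + j) - k),
          (j.choose r * k.choose (n - (2 * k + j) - k - r) : ℤ) * a₁ ^ (j - r) * a₂ ^ r *
            a₃ ^ (2 * k + (2 * k + j) + r - n) * a₄ ^ (n - (2 * k + j) - k - r) := by
  obtain ⟨F, hF⟩ : ∃ F : ℕ → ℕ → ℤ, ∀ m k, F m k = ∑ r ∈ range (n + 1 - m - k),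
      (m.choose k * (m - k).choose k * (m - 2 * k).choose r * k.choose (n - m - k - r) : ℤ) *
        a₁ ^ (m - 2 * k - r) * a₂ ^ r * a₃ ^ (2 * k + m + r - n) * a₄ ^ (n - m - k - r) :=
    ⟨_, fun _ _ => rfl⟩
  have h₁ : bCoeff a₁ a₂ a₃ a₄ n = ∑ m ∈ Icc (n / 2) n, ∑ k ∈ range (m / 2 + 1), F m k := by
    simp only [bCoeff, hF]
  have h₂ : ∑ m ∈ Icc (n / 2) n, ∑ k ∈ range (m / 2 + 1), F m k =
      ∑ m ∈ range (n + 1), ∑ k ∈ range (m / 2 + 1), F m k := by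
    refine sum_subset (fun m hm => ?_) fun m hm hm' => sum_eq_zero fun k hk => ?_
    · simp only [mem_Icc, mem_range] at hm ⊢
      omega
    · simp only [mem_Icc, mem_range, not_and, not_le] at hm hm' hk
      rw [hF]
      refine sum_eq_zero fun r hr => ?_
      rw [mem_range] at hr
      rcases lt_or_ge (m - 2 * k) r with h | h
      · simp [Nat.choose_eq_zero_of_lt h]
      · have h' : k < n - m - k - r := by
          by_contra h'
          have := hm'
          omega
        simp [Nat.choose_eq_zero_of_lt h']
  have h₃ : ∀ m ∈ range (n + 1), ∑ k ∈ range (m / 2 + 1), F m k =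
      ∑ k ∈ range (n + 1), if 2 * k ≤ m then F m k else 0 := by
    intro m hm
    rw [← sum_filter]
    refine sum_congr (ext fun k => ?_) fun _ _ => rfl
    simp only [mem_filter, mem_range] at hm ⊢
    omega
  rw [h₁, h₂, sum_congr rfl h₃, sum_comm]
  refine sum_congr rfl fun k _ => ?_
  rw [sum_range_ite_le_eq n (2 * k) (F · k), mul_sum]
  · refine sum_congr rfl fun j _ => ?_
    rw [hF, mul_sum, mul_sum]
    refine sum_congr rfl fun r _ => ?_
    have hc := congrArg (Nat.cast (R := ℤ)) (choose_mul_choose_eq_centralBinom_mul k j)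
    push_cast at hc
    rw [hc, show 2 * k + j - 2 * k = j by omega]
    ring
  · intro m hm
    rw [hF, show n + 1 - m - k = 0 by omega, sum_range_zero]

theorem exists_formalEquation_X (a₁ a₂ a₃ a₄ : ℤ) : ∃ w₀ : ℤ⟦X⟧, constantCoeff w₀ = 0 ∧
    WeierstrassCurve.FormalEquation
      ((WeierstrassCurve.mk a₁ a₂ a₃ a₄ 0).map (PowerSeries.C : ℤ →+* ℤ⟦X⟧)) X w₀ ∧
    WeierstrassCurve.formalDen
      ((WeierstrassCurve.mk a₁ a₂ a₃ a₄ 0).map (PowerSeries.C : ℤ →+* ℤ⟦X⟧)) X w₀ *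
      PowerSeries.mk (bCoeff a₁ a₂ a₃ a₄) = 1 := by
  obtain ⟨B, hB⟩ : ∃ B : ℤ⟦X⟧, B = PowerSeries.C a₁ * X + PowerSeries.C a₂ * X ^ 2 := ⟨_, rfl⟩
  obtain ⟨D, hD⟩ : ∃ D : ℤ⟦X⟧, D = X ^ 3 * (PowerSeries.C a₃ + PowerSeries.C a₄ * X) := ⟨_, rfl⟩
  have hB₀ : constantCoeff B = 0 := by simp [hB]
  have hD₀ : constantCoeff D = 0 := by simp [hD]
  obtain ⟨ψ, hψ⟩ := exists_ringHom_X_eq hB₀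
  obtain ⟨e, he⟩ : ∃ e, e = ψ (PowerSeries.mk 1) := ⟨_, rfl⟩
  have he₁ : e * (1 - B) = 1 := by
    have := congrArg ψ (mk_one_mul_one_sub_eq_one ℤ)
    simpa [hψ, ← he] using this
  have heD : constantCoeff (D * e ^ 2) = 0 := by simp [hD₀]
  obtain ⟨φ, hφ⟩ := exists_ringHom_X_eq heD
  obtain ⟨c, hc⟩ : ∃ c, c = φ (PowerSeries.mk fun n => (catalan n : ℤ)) := ⟨_, rfl⟩
  have hc₁ : c = 1 + D * e ^ 2 * c ^ 2 := by
    have := congrArg φ (catalan_series_eq ℤ)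
    simpa only [map_add, map_mul, map_pow, map_one, hφ, ← hc] using this
  have hg₁ : φ (PowerSeries.mk fun n => (n.centralBinom : ℤ)) * (1 - 2 * (D * e ^ 2) * c) = 1 := by
    have := congrArg φ (centralBinom_series_mul ℤ)
    simpa only [map_sub, map_mul, map_pow, map_one, hφ, ← hc, map_ofNat] using this
  have hg : PowerSeries.mk (bCoeff a₁ a₂ a₃ a₄) =
      φ (PowerSeries.mk fun n => (n.centralBinom : ℤ)) * e := by
    ext n
    rw [coeff_ringHom_mul φ hφ heD, coeff_mk, bCoeff_eq_sum]
    refine sum_congr rfl fun k _ => ?_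
    rw [coeff_mk, show (D * e ^ 2) ^ k * e = ψ (PowerSeries.mk 1 ^ (2 * k + 1)) * D ^ k by
      rw [map_pow, ← he]; ring, mk_one_pow_eq_mk_choose_add, coeff_ringHom_mul ψ hψ hB₀]
    congr 1
    refine sum_congr rfl fun j _ => ?_
    rw [coeff_mk, hB, hD, coeff_pow_mul_pow]
  refine ⟨X ^ 3 * e * c, by simp, ?_, ?_⟩
  · simp only [WeierstrassCurve.FormalEquation, WeierstrassCurve.map_a₁, WeierstrassCurve.map_a₂,
      WeierstrassCurve.map_a₃, WeierstrassCurve.map_a₄]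
    rw [hB] at he₁
    rw [hD] at hc₁
    linear_combination X ^ 3 * hc₁ + X ^ 3 * c * he₁
  · rw [hg]
    simp only [WeierstrassCurve.formalDen, WeierstrassCurve.map_a₁, WeierstrassCurve.map_a₂,
      WeierstrassCurve.map_a₃, WeierstrassCurve.map_a₄]
    rw [hB] at he₁
    rw [hD] at hg₁
    linear_combination hg₁ + φ (PowerSeries.mk fun n => (n.centralBinom : ℤ)) * he₁

/-- The Atkin–Swinnerton-Dyer congruence
`b(np) − t_p·b(n) + p·b(n‖p) ≡ 0 (mod p^s)` for `p^{s−1} ∣ n`. -/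
theorem stmt7 (a₁ a₂ a₃ a₄ : ℤ)
    (hΔ : (WeierstrassCurve.mk a₁ a₂ a₃ a₄ 0).Δ ≠ 0)
    (p : ℕ) (hp : p.Prime) (hpΔ : ¬ ((p : ℤ) ∣ (WeierstrassCurve.mk a₁ a₂ a₃ a₄ 0).Δ))
    (b : ℕ → ℤ) (hb : ∀ n : ℕ, 1 ≤ n → b n = bCoeff a₁ a₂ a₃ a₄ (n - 1))
    (Ap : ℕ)
    (hAp : Ap = 1 + Nat.card {P : ZMod p × ZMod p //
      P.2 ^ 2 + (a₁ : ZMod p) * P.1 * P.2 + (a₃ : ZMod p) * P.2 =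
        P.1 ^ 3 + (a₂ : ZMod p) * P.1 ^ 2 + (a₄ : ZMod p) * P.1})
    (tp : ℤ) (htp : tp = 1 + (p : ℤ) - (Ap : ℤ))
    (s : ℕ) (hs : 1 ≤ s) (n : ℕ) (hn : 0 < n) (hpsn : p ^ (s - 1) ∣ n) :
    b (n * p) - tp * b n + (p : ℤ) * (if p ∣ n then b (n / p) else 0) ≡ 0
      [ZMOD (p ^ s : ℕ)] := by
  subst htp hAp
  have : Fact p.Prime := ⟨hp⟩
  have hell : ((WeierstrassCurve.mk a₁ a₂ a₃ a₄ 0).map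
      (Int.castRingHom (ZMod p))).IsElliptic := by
    rw [WeierstrassCurve.isElliptic_iff, WeierstrassCurve.map_Δ, isUnit_iff_ne_zero, eq_intCast,
      Ne, ZMod.intCast_zmod_eq_zero_iff_dvd]
    exact hpΔ
  obtain ⟨w₀, hw₀, hE, hg⟩ := exists_formalEquation_X a₁ a₂ a₃ a₄
  have hd : p ^ s ∣ n * p := by
    obtain ⟨d, rfl⟩ := Nat.exists_eq_add_of_le' hs
    rw [pow_succ]
    exact mul_dvd_mul_right hpsn p
  have hcard : Nat.card {P : ZMod p × ZMod p //
      P.2 ^ 2 + (a₁ : ZMod p) * P.1 * P.2 + (a₃ : ZMod p) * P.2 =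
        P.1 ^ 3 + (a₂ : ZMod p) * P.1 ^ 2 + (a₄ : ZMod p) * P.1} =
      Nat.card {P : ZMod p × ZMod p // WeierstrassCurve.Affine.Equation
        ((WeierstrassCurve.mk a₁ a₂ a₃ a₄ 0).map (Int.castRingHom (ZMod p))) P.1 P.2} := by
    refine Nat.card_congr (Equiv.subtypeEquivRight fun P => ?_)
    simp [WeierstrassCurve.Affine.equation_iff]
  have key := WeierstrassCurve.coeff_congruence rfl hE hw₀ hg hp rfl hn.ne' hd
  simp only [coeff_mk] at key
  rw [Int.modEq_zero_iff_dvd, hb _ (Nat.mul_pos hn hp.pos), hb _ hn, hcard]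
  push_cast
  rw [add_sub_add_left_eq_sub]
  split_ifs at key ⊢ with hpn
  · rwa [hb _ (Nat.div_pos (Nat.le_of_dvd hn hpn) hp.pos)]
  · exact key
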